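/- arXiv:2202.07051 — 2 statements merged into one kernel-verified Lean document; each statement's English description precedes it below -/
import Mathlib

section
/- Let f = {f_w} be a random dynamical system and μ ∈ M(E, f) ergodic with positive fiber entropy h_μ(f) > 0. Then μ is positively random expansive: there exists a random variable δ : Ω → (0,∞) such that for ℙ-a.e. w, μ_w(Γ_δ⁺(x, w)) = 0 for all x ∈ E_w. -/
open MeasureTheory Filter

noncomputable section

/-- Forward composition of fiber maps along the base orbit:
`fiterate f θ n w = f_{θ^{n-1}w} ∘ ⋯ ∘ f_w`. -/
def fiterate {Ω X : Type*} (f : Ω → X → X) (θ : Ω → Ω) : ℕ → Ω → X → X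
  | 0, _, x => x
  | n + 1, w, x => fiterate f θ n (θ w) (f w x)

/-- One-sided random dynamical ball
`Γ_δ⁺(x, w) = {y : d(f_wⁿ(x), f_wⁿ(y)) ≤ δ(θⁿ w) for all n ≥ 0}`. -/
def GammaPlus {Ω X : Type*} [MetricSpace X] (f : Ω → X → X) (θ : Ω → Ω)
    (δ : Ω → ℝ) (w : Ω) (x : X) : Set X :=
  {y : X | ∀ n : ℕ, dist (fiterate f θ n w x) (fiterate f θ n w y) ≤ δ (θ^[n] w)}

/-- The fiber over `w` of the cell, indexed by an itinerary `s`, of the `n`-th dynamical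
refinement `⋁_{j<n} (Fʲ)⁻¹(P)` of a finite partition `P` of `Ω × X`. -/
def cellSet {Ω X : Type*} (f : Ω → X → X) (θ : Ω → Ω) {m : ℕ}
    (P : Fin m → Set (Ω × X)) (w : Ω) {n : ℕ} (s : Fin n → Fin m) : Set X :=
  ⋂ j : Fin n, {x : X | (θ^[(j : ℕ)] w, fiterate f θ j w x) ∈ P (s j)}

/-- Conditional entropy `H_μ(⋁_{j<n} (Fʲ)⁻¹(P) | F_E)` of the `n`-th dynamical
refinement of the partition `P`, computed fiberwise and integrated over the base. -/
def fiberHn {Ω X : Type*} [MeasurableSpace Ω] [MeasurableSpace X]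
    (ℙ : Measure Ω) (μ : Ω → Measure X) (f : Ω → X → X) (θ : Ω → Ω) {m : ℕ}
    (P : Fin m → Set (Ω × X)) (n : ℕ) : ℝ :=
  ∫ w, (∑ s : Fin n → Fin m,
    Real.negMulLog ((μ w (cellSet f θ P w s)).toReal)) ∂ℙ

/-- Fiber entropy of the partition `P`. -/
def fiberEntropyOfPartition {Ω X : Type*} [MeasurableSpace Ω] [MeasurableSpace X]
    (ℙ : Measure Ω) (μ : Ω → Measure X) (f : Ω → X → X) (θ : Ω → Ω) {m : ℕ}
    (P : Fin m → Set (Ω × X)) : ℝ :=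
  liminf (fun n : ℕ => fiberHn ℙ μ f θ P n / n) atTop

/-- Relative (fiber) entropy `h_μ(f)` of the random dynamical system: supremum over all
finite measurable partitions of `Ω × X` of the fiber entropy of the partition. -/
def fiberEntropy {Ω X : Type*} [MeasurableSpace Ω] [MeasurableSpace X]
    (ℙ : Measure Ω) (μ : Ω → Measure X) (f : Ω → X → X) (θ : Ω → Ω) : ℝ :=
  ⨆ (m : ℕ) (P : Fin m → Set (Ω × X))
    (_ : (∀ i, MeasurableSet (P i)) ∧ Pairwise (Function.onFun Disjoint P) ∧
      (⋃ i, P i) = Set.univ),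
    fiberEntropyOfPartition ℙ μ f θ P


/-! ### Disintegrations are almost everywhere equal to a kernel -/

theorem aemeasurable_of_lintegral_add_lintegral_one_sub {Ω : Type*} [MeasurableSpace Ω]
    (ℙ : Measure Ω) [IsProbabilityMeasure ℙ] (h : Ω → ENNReal) (hle : ∀ w, h w ≤ 1)
    (hsum : ∫⁻ w, h w ∂ℙ + ∫⁻ w, (1 - h w) ∂ℙ = 1) : AEMeasurable h ℙ := by
  obtain ⟨g, hg, hgh, hgi⟩ := exists_measurable_le_lintegral_eq ℙ h
  obtain ⟨g', hg', hgh', hgi'⟩ := exists_measurable_le_lintegral_eq ℙ (fun w => 1 - h w)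
  have hle' : ∀ w, g w + g' w ≤ 1 := fun w =>
    (add_le_add (hgh w) (hgh' w)).trans (by simp [add_tsub_cancel_of_le (hle w)])
  have hint : ∫⁻ w, (g w + g' w) ∂ℙ = 1 := by
    rw [lintegral_add_left hg, ← hgi, ← hgi', hsum]
  have hae : (fun w => g w + g' w) =ᵐ[ℙ] fun _ => 1 := by
    refine ae_eq_of_ae_le_of_lintegral_le (.of_forall hle') (by simp [hint]) (by fun_prop) ?_
    simp [hint]
  refine ⟨g, hg, ?_⟩
  filter_upwards [hae] with w hw
  refine le_antisymm ?_ (hgh w)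
  have h1 : h w + g' w ≤ 1 :=
    (add_le_add le_rfl (hgh' w)).trans (by simp [add_tsub_cancel_of_le (hle w)])
  have h2 : g' w ≠ ⊤ := ((le_add_self).trans (hle' w)).trans_lt ENNReal.one_lt_top |>.ne
  exact (ENNReal.add_le_add_iff_right h2).1 (h1.trans hw.ge)

theorem ae_eq_condKernel_of_disintegration {Ω X : Type*} [MeasurableSpace Ω] [MeasurableSpace X]
    [StandardBorelSpace X] [Nonempty X]
    (ℙ : Measure Ω) [IsProbabilityMeasure ℙ]
    (μ : Ω → Measure X) (hμprob : ∀ w, IsProbabilityMeasure (μ w))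
    (μtot : Measure (Ω × X)) [IsProbabilityMeasure μtot]
    (hmarg : μtot.map Prod.fst = ℙ)
    (hdisint : ∀ s : Set (Ω × X), MeasurableSet s →
      μtot s = ∫⁻ w, μ w (Prod.mk w ⁻¹' s) ∂ℙ) :
    ∀ᵐ w ∂ℙ, μ w = μtot.condKernel w := by
  have hfst : μtot.fst = ℙ := hmarg
  have hdis : Measure.compProd ℙ μtot.condKernel = μtot := by rw [← hfst]; exact μtot.disintegrate _
  have hmeas : ∀ B : Set X, MeasurableSet B → AEMeasurable (fun w => μ w B) ℙ := by
    intro B hB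
    refine aemeasurable_of_lintegral_add_lintegral_one_sub ℙ _ (fun w => prob_le_one) ?_
    have h1 := hdisint (Set.univ ×ˢ B) (MeasurableSet.univ.prod hB)
    have h2 := hdisint (Set.univ ×ˢ B)ᶜ (MeasurableSet.univ.prod hB).compl
    have e1 : ∀ w : Ω, Prod.mk w ⁻¹' ((Set.univ : Set Ω) ×ˢ B) = B := by intro w; ext x; simp
    have e2 : ∀ w : Ω, Prod.mk w ⁻¹' ((Set.univ : Set Ω) ×ˢ B)ᶜ = Bᶜ := by intro w; ext x; simp
    simp only [e1, e2] at h1 h2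
    simp only [prob_compl_eq_one_sub hB] at h2
    rw [← h1, ← h2]
    exact prob_add_prob_compl (MeasurableSet.univ.prod hB)
  have heq : ∀ B : Set X, MeasurableSet B → (fun w => μ w B) =ᵐ[ℙ] fun w => μtot.condKernel w B := by
    intro B hB
    refine ae_eq_of_forall_setLIntegral_eq_of_sigmaFinite₀ (hmeas B hB)
      (ProbabilityTheory.Kernel.measurable_coe _ hB).aemeasurable ?_
    intro A hA _
    have h1 := hdisint (A ×ˢ B) (hA.prod hB)
    have h2 := Measure.compProd_apply_prod (μ := ℙ) (κ := μtot.condKernel) hA hB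
    rw [hdis] at h2
    rw [← h2, h1, ← lintegral_indicator hA]
    congr 1 with w
    by_cases hw : w ∈ A
    · simp [hw, Set.mk_preimage_prod_right]
    · simp [hw]
  let _ := upgradeStandardBorel X
  set C := generateSetAlgebra (TopologicalSpace.countableBasis X)
  have hCc : C.Countable := countable_generateSetAlgebra (TopologicalSpace.countable_countableBasis X)
  have hgen : ‹MeasurableSpace X› = MeasurableSpace.generateFrom C := by
    rw [generateFrom_generateSetAlgebra_eq,
      ← (TopologicalSpace.isBasis_countableBasis X).borel_eq_generateFrom]
    exact BorelSpace.measurable_eq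
  have hall : ∀ᵐ w ∂ℙ, ∀ B ∈ C, μ w B = μtot.condKernel w B := by
    rw [ae_ball_iff hCc]
    intro B hB
    exact heq B (hgen.symm.le B (MeasurableSpace.measurableSet_generateFrom hB))
  filter_upwards [hall] with w hw
  have := hμprob w
  exact ext_of_generate_finite C hgen isSetAlgebra_generateSetAlgebra.isSetRing.isSetSemiring.isPiSystem
    hw (by simp)

/-! ### An entropy bound by coding -/

theorem sum_negMulLog_le_integral {X S : Type*} [MeasurableSpace X] [Fintype S]
    (ν : Measure X) [IsProbabilityMeasure ν] (cell : S → Set X)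
    (hmeas : ∀ s, MeasurableSet (cell s)) (hdisj : Pairwise (Function.onFun Disjoint cell))
    (hcov : ⋃ s, cell s = Set.univ) (q : S → ℝ) (hq : ∀ s, 0 < q s) (hqs : ∑ s, q s ≤ 1)
    (g : X → ℝ) (hg : Integrable g ν) (hqg : ∀ s, ∀ x ∈ cell s, -Real.log (q s) ≤ g x) :
    ∑ s, Real.negMulLog (ν (cell s)).toReal ≤ ∫ x, g x ∂ν := by
  have hsum : ∑ s, (ν (cell s)).toReal = 1 := by
    have h := measureReal_iUnion_fintype (μ := ν) hdisj hmeas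
    rw [hcov] at h
    simpa [measureReal_def] using h.symm
  have hint : ∫ x, g x ∂ν = ∑ s, ∫ x in cell s, g x ∂ν := by
    rw [← integral_iUnion_fintype hmeas hdisj (fun s => hg.integrableOn), hcov, setIntegral_univ]
  have hterm : ∀ s, Real.negMulLog (ν (cell s)).toReal ≤
      (∫ x in cell s, g x ∂ν) + (q s - (ν (cell s)).toReal) := by
    intro s
    set p := (ν (cell s)).toReal with hp
    have hlow : p * (-Real.log (q s)) ≤ ∫ x in cell s, g x ∂ν := by
      have h := setIntegral_mono_on (μ := ν) (s := cell s) (f := fun _ => -Real.log (q s)) (g := g)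
        (integrable_const _).integrableOn hg.integrableOn (hmeas s) (hqg s)
      simpa [measureReal_def, hp] using h
    rcases (ENNReal.toReal_nonneg : 0 ≤ (ν (cell s)).toReal).eq_or_lt with h0 | h0
    · have : p = 0 := h0.symm
      rw [this] at hlow ⊢
      simp at hlow ⊢
      linarith [hq s]
    · have h1 := Real.log_le_sub_one_of_pos (div_pos (hq s) h0)
      rw [Real.log_div (hq s).ne' h0.ne'] at h1
      have h2 := mul_le_mul_of_nonneg_left h1 h0.le
      have h3 : p * (q s / p - 1) = q s - p := by
        have : p ≠ 0 := h0.ne'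
        field_simp
      rw [h3] at h2
      rw [Real.negMulLog]
      linarith
  calc _ ≤ ∑ s, ((∫ x in cell s, g x ∂ν) + (q s - (ν (cell s)).toReal)) :=
        Finset.sum_le_sum fun s _ => hterm s
    _ ≤ _ := by
        rw [Finset.sum_add_distrib, Finset.sum_sub_distrib, hsum, ← hint]
        linarith

/-- The normalized weight, at tolerance `τ`, of the letter `a` when the letter `b` is predicted. -/
def codeWeight {m : ℕ} (τ : ℝ) (a b : Fin m) : ℝ := (if a = b then 1 else τ) / (1 + m * τ)

theorem codeWeight_pos {m : ℕ} {τ : ℝ} (hτ : 0 < τ) (a b : Fin m) : 0 < codeWeight τ a b := by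
  unfold codeWeight
  split_ifs <;> positivity

theorem sum_codeWeight_le_one {m : ℕ} {τ : ℝ} (hτ : 0 < τ) (b : Fin m) :
    ∑ a, codeWeight τ a b ≤ 1 := by
  unfold codeWeight
  rw [← Finset.sum_div, div_le_one (by positivity)]
  calc ∑ a : Fin m, (if a = b then (1 : ℝ) else τ) ≤ ∑ a : Fin m, ((if a = b then 1 else 0) + τ) :=
        Finset.sum_le_sum fun a _ => by split_ifs <;> linarith
    _ = 1 + m * τ := by simp [Finset.sum_add_distrib]

theorem neg_log_codeWeight_le {m : ℕ} {τ : ℝ} (hτ : 0 < τ) (a b : Fin m) :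
    -Real.log (codeWeight τ a b) ≤ m * τ + (if a = b then 0 else 1) * (-Real.log τ) := by
  have h : Real.log (1 + m * τ) ≤ m * τ := by
    have := Real.log_le_sub_one_of_pos (show 0 < 1 + m * τ by positivity)
    linarith
  unfold codeWeight
  rw [Real.log_div (by split_ifs <;> positivity) (by positivity)]
  split_ifs <;> simp <;> linarith

/-- If every point of the fiber admits, up to `g` errors among its first `n` labels, one of at
most `M` predictions, then the entropy of the `n`-cells is controlled by `M` and the errors. -/
theorem sum_negMulLog_le_of_predictions {X : Type*} [MeasurableSpace X]
    (ν : Measure X) [IsProbabilityMeasure ν] {m n : ℕ} (cell : (Fin n → Fin m) → Set X)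
    (hmeas : ∀ s, MeasurableSet (cell s)) (hdisj : Pairwise (Function.onFun Disjoint cell))
    (hcov : ⋃ s, cell s = Set.univ) {τ : ℝ} (hτ : 0 < τ) (hτ1 : τ ≤ 1)
    (Z : Finset (ℕ → Fin m)) (M : ℕ) (hM : 0 < M) (hZ : Z.card ≤ M)
    (g : X → ℝ) (hg : Integrable g ν)
    (hpred : ∀ s, ∀ x ∈ cell s, ∃ z ∈ Z,
      (∑ j : Fin n, if s j = z j then (0 : ℝ) else 1) ≤ g x) :
    ∑ s, Real.negMulLog (ν (cell s)).toReal ≤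
      ∫ x, (Real.log M + n * (m * τ) + (-Real.log τ) * g x) ∂ν := by
  have hL : 0 ≤ -Real.log τ := by linarith [Real.log_nonpos hτ.le hτ1]
  have hMr : (0 : ℝ) < M := by exact_mod_cast hM
  rcases Z.eq_empty_or_nonempty with rfl | hZne
  · exfalso
    have hempty : ∀ s, cell s = ∅ := fun s => Set.eq_empty_of_forall_notMem fun x hx => by
      simpa using hpred s x hx
    simp [hempty] at hcov
    have := (ν.nonempty_of_neZero)
    exact Set.empty_ne_univ hcov
  have hprodpos : ∀ (s : Fin n → Fin m) (z : ℕ → Fin m), 0 < ∏ j, codeWeight τ (s j) (z j) :=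
    fun s z => Finset.prod_pos fun j _ => codeWeight_pos hτ _ _
  refine sum_negMulLog_le_integral ν cell hmeas hdisj hcov
    (fun s => (∑ z ∈ Z, ∏ j, codeWeight τ (s j) (z j)) / M)
    (fun s => div_pos (Finset.sum_pos (fun z _ => hprodpos s z) hZne) hMr) ?_ _
    ((integrable_const _).add (hg.const_mul _)) ?_
  · rw [← Finset.sum_div, div_le_one hMr, Finset.sum_comm]
    calc ∑ z ∈ Z, ∑ s : Fin n → Fin m, ∏ j, codeWeight τ (s j) (z j)
        ≤ ∑ z ∈ Z, (1 : ℝ) := by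
          refine Finset.sum_le_sum fun z _ => ?_
          rw [← Fintype.prod_sum (fun (j : Fin n) a => codeWeight τ a (z j))]
          exact Finset.prod_le_one
            (fun j _ => Finset.sum_nonneg fun a _ => (codeWeight_pos hτ _ _).le)
            (fun j _ => sum_codeWeight_le_one hτ _)
      _ ≤ M := by simpa using hZ
  · intro s x hx
    obtain ⟨z, hz, hgx⟩ := hpred s x hx
    have h1 : ∏ j, codeWeight τ (s j) (z j) ≤ ∑ z ∈ Z, ∏ j, codeWeight τ (s j) (z j) :=
      Finset.single_le_sum (f := fun z : ℕ → Fin m => ∏ j, codeWeight τ (s j) (z j))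
        (fun z _ => (hprodpos s z).le) hz
    have h2 := Real.log_le_log (hprodpos s z) h1
    rw [Real.log_div (Finset.sum_pos (fun z _ => hprodpos s z) hZne).ne' hMr.ne']
    rw [Real.log_prod (fun j _ => (codeWeight_pos hτ _ _).ne')] at h2
    have h3 : -∑ j, Real.log (codeWeight τ (s j) (z j)) ≤
        n * (m * τ) + (∑ j : Fin n, if s j = z j then (0 : ℝ) else 1) * (-Real.log τ) := by
      rw [← Finset.sum_neg_distrib, Finset.sum_mul]
      refine (Finset.sum_le_sum fun j _ => neg_log_codeWeight_le hτ (s j) (z j)).trans ?_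
      simp [Finset.sum_add_distrib]
    nlinarith [mul_le_mul_of_nonneg_right hgx hL]

/-! ### Sets that are locally constant along fibers off a small set -/

/-- Off a set of small measure, membership in `S` is constant at some scale in the fibers. -/
def AlmostLocallyConstant {Ω X : Type*} [MeasurableSpace Ω] [MetricSpace X] [MeasurableSpace X]
    (μ : Measure (Ω × X)) (S : Set (Ω × X)) : Prop :=
  ∀ ε : ENNReal, 0 < ε → ∃ G : Set (Ω × X), MeasurableSet G ∧ μ Gᶜ ≤ ε ∧ ∃ δ : ℝ, 0 < δ ∧
    ∀ w y y', (w, y) ∈ G → (w, y') ∈ G → dist y y' ≤ δ → (w, y) ∈ S → (w, y') ∈ S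

namespace AlmostLocallyConstant

variable {Ω X : Type*} [MeasurableSpace Ω] [MetricSpace X] [MeasurableSpace X]
  {μ : Measure (Ω × X)}

theorem compl {S : Set (Ω × X)} (h : AlmostLocallyConstant μ S) :
    AlmostLocallyConstant μ Sᶜ := by
  intro ε hε
  obtain ⟨G, hG, hGμ, δ, hδ, H⟩ := h ε hε
  refine ⟨G, hG, hGμ, δ, hδ, fun w y y' hy hy' hd hS hS' => hS ?_⟩
  exact H w y' y hy' hy (by rwa [dist_comm]) hS'

/-- A finite family of almost locally constant sets has a common good set and scale. -/
theorem exists_common {ι : Type*} [Finite ι] {S : ι → Set (Ω × X)}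
    (h : ∀ i, AlmostLocallyConstant μ (S i)) {ε : ENNReal} (hε : 0 < ε) :
    ∃ G : Set (Ω × X), MeasurableSet G ∧ μ Gᶜ ≤ ε ∧ ∃ δ : ℝ, 0 < δ ∧
      ∀ i w y y', (w, y) ∈ G → (w, y') ∈ G → dist y y' ≤ δ → (w, y) ∈ S i → (w, y') ∈ S i := by
  obtain ⟨ε', hε', hsum⟩ := ENNReal.exists_pos_sum_of_countable' hε.ne' ι
  choose G hG hGμ δ hδ H using fun i => h i (ε' i) (hε' i)
  obtain ⟨δ₀, hδ₀, hle⟩ : ∃ δ₀ : ℝ, 0 < δ₀ ∧ ∀ i, δ₀ ≤ δ i := by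
    cases isEmpty_or_nonempty ι
    · exact ⟨1, one_pos, fun i => isEmptyElim i⟩
    · obtain ⟨i, hi⟩ := Finite.exists_min δ
      exact ⟨δ i, hδ i, hi⟩
  refine ⟨⋂ i, G i, .iInter hG, ?_, δ₀, hδ₀, fun i w y y' hy hy' hd hS => ?_⟩
  · rw [Set.compl_iInter]
    exact (measure_iUnion_le _).trans ((ENNReal.tsum_le_tsum hGμ).trans hsum.le)
  · exact H i w y y' (Set.mem_iInter.1 hy i) (Set.mem_iInter.1 hy' i) (hd.trans (hle i)) hS

theorem iUnion [IsFiniteMeasure μ] {S : ℕ → Set (Ω × X)} (hS : ∀ n, MeasurableSet (S n))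
    (h : ∀ n, AlmostLocallyConstant μ (S n)) : AlmostLocallyConstant μ (⋃ n, S n) := by
  intro ε hε
  have hε2 : 0 < ε / 2 := ENNReal.half_pos hε.ne'
  obtain ⟨N, hN⟩ : ∃ N, μ ((⋃ n, S n) \ Set.accumulate S N) ≤ ε / 2 := by
    have ht : Tendsto (fun N => μ ((⋃ n, S n) \ Set.accumulate S N)) atTop
        (nhds (μ (⋂ N, ((⋃ n, S n) \ Set.accumulate S N)))) := by
      refine tendsto_measure_iInter_atTop (fun N => ?_) (fun a b hab => ?_)
        ⟨0, measure_ne_top _ _⟩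
      · exact ((MeasurableSet.iUnion hS).diff (.biUnion (Set.to_countable _) fun n _ => hS n)).nullMeasurableSet
      · exact Set.sdiff_subset_sdiff_right (Set.monotone_accumulate hab)
    have h0 : ⋂ N, ((⋃ n, S n) \ Set.accumulate S N) = ∅ := by
      rw [← Set.sdiff_iUnion, Set.iUnion_accumulate, Set.sdiff_self]
    rw [h0, measure_empty] at ht
    exact ((ht.eventually_lt_const hε2).exists).imp fun N h => h.le
  obtain ⟨G, hG, hGμ, δ, hδ, H⟩ := exists_common (fun i : Fin (N + 1) => h i) hε2
  refine ⟨G \ ((⋃ n, S n) \ Set.accumulate S N),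
    hG.diff ((MeasurableSet.iUnion hS).diff (.biUnion (Set.to_countable _) fun n _ => hS n)), ?_, δ, hδ, ?_⟩
  · rw [Set.sdiff_eq, Set.compl_inter, compl_compl, ← ENNReal.add_halves ε]
    exact (measure_union_le _ _).trans (add_le_add hGμ hN)
  · intro w y y' hy hy' hd hyS
    have hacc : (w, y) ∈ Set.accumulate S N := by
      by_contra hcon
      exact hy.2 ⟨hyS, hcon⟩
    obtain ⟨n, hn, hyn⟩ := Set.mem_accumulate.1 hacc
    exact Set.mem_iUnion.2 ⟨n, H ⟨n, Nat.lt_succ_of_le hn⟩ w y y' hy.1 hy'.1 hd hyn⟩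

theorem preimage_fst (A : Set Ω) : AlmostLocallyConstant μ (Prod.fst ⁻¹' A) := by
  intro ε hε
  exact ⟨Set.univ, .univ, by simp, 1, one_pos, fun w y y' _ _ _ h => h⟩

theorem preimage_snd_of_isOpen [BorelSpace X] [IsFiniteMeasure μ] {U : Set X} (hU : IsOpen U) :
    AlmostLocallyConstant μ (Prod.snd ⁻¹' U) := by
  intro ε hε
  let D : ℕ → Set (Ω × X) := fun n =>
    Prod.snd ⁻¹' (U ∩ {x | Metric.infEDist x Uᶜ ≤ ENNReal.ofReal (1 / (n + 1))})
  have hD : ∀ n, MeasurableSet (D n) := fun n => measurable_snd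
    (hU.measurableSet.inter (Metric.continuous_infEDist.measurable measurableSet_Iic))
  obtain ⟨n, hn⟩ : ∃ n, μ (D n) ≤ ε := by
    have ht : Tendsto (fun n => μ (D n)) atTop (nhds (μ (⋂ n, D n))) := by
      refine tendsto_measure_iInter_atTop (fun n => (hD n).nullMeasurableSet) (fun a b hab => ?_)
        ⟨0, measure_ne_top _ _⟩
      refine Set.preimage_mono (Set.inter_subset_inter_right _ fun x hx => ?_)
      refine le_trans (show _ ≤ _ from hx) (ENNReal.ofReal_le_ofReal ?_)
      exact one_div_le_one_div_of_le (by positivity) (by exact_mod_cast Nat.succ_le_succ hab)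
    have h0 : ⋂ n, D n = ∅ := by
      refine Set.eq_empty_of_forall_notMem fun p hp => ?_
      have hp' := Set.mem_iInter.1 hp
      have hz : Metric.infEDist p.2 Uᶜ = 0 := by
        refine le_antisymm (ge_of_tendsto' (x := atTop)
          (f := fun n : ℕ => ENNReal.ofReal (1 / ((n : ℝ) + 1))) ?_ fun n => (hp' n).2) zero_le
        simpa using ENNReal.tendsto_ofReal tendsto_one_div_add_atTop_nhds_zero_nat
      have hmem := Metric.mem_closure_iff_infEDist_zero.2 hz
      rw [hU.isClosed_compl.closure_eq] at hmem
      exact hmem (hp' 0).1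
    rw [h0, measure_empty] at ht
    exact ((ht.eventually_lt_const hε).exists).imp fun N h => h.le
  refine ⟨(D n)ᶜ, (hD n).compl, by rwa [compl_compl], 1 / (n + 1), by positivity, ?_⟩
  intro w y y' hy _ hd hyU
  by_contra hy'U
  refine hy ⟨hyU, ?_⟩
  have h1 : Metric.infEDist y Uᶜ ≤ edist y y' := Metric.infEDist_le_edist_of_mem hy'U
  exact h1.trans (by rw [edist_dist]; exact ENNReal.ofReal_le_ofReal hd)

theorem of_measurableSet [BorelSpace X] [IsFiniteMeasure μ] {S : Set (Ω × X)}
    (hS : MeasurableSet S) : AlmostLocallyConstant μ S := by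
  let m' : MeasurableSpace (Ω × X) :=
    { MeasurableSet' := fun S => MeasurableSet S ∧ AlmostLocallyConstant μ S
      measurableSet_empty := ⟨.empty, fun ε _ => ⟨Set.univ, .univ, by simp, 1, one_pos, by simp⟩⟩
      measurableSet_compl := fun S hS => ⟨hS.1.compl, hS.2.compl⟩
      measurableSet_iUnion := fun S hS =>
        ⟨.iUnion fun n => (hS n).1, iUnion (fun n => (hS n).1) fun n => (hS n).2⟩ }
  have hle : (Prod.instMeasurableSpace : MeasurableSpace (Ω × X)) ≤ m' := by
    refine sup_le ?_ ?_
    · rintro _ ⟨A, hA, rfl⟩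
      exact ⟨measurable_fst hA, preimage_fst A⟩
    · rw [← measurable_iff_comap_le]
      have hsnd : @Measurable _ _ m' (borel X) Prod.snd := measurable_generateFrom fun U hU =>
        ⟨measurable_snd (IsOpen.measurableSet hU), preimage_snd_of_isOpen hU⟩
      exact hsnd.mono le_rfl BorelSpace.measurable_eq.le
  exact (hle S hS).2

end AlmostLocallyConstant

/-! ### Fiber iterates and dynamical balls -/

theorem iterate_skew {Ω X : Type*} (f : Ω → X → X) (θ : Ω → Ω) (n : ℕ) (w : Ω) (x : X) :
    (fun p : Ω × X => (θ p.1, f p.1 p.2))^[n] (w, x) = (θ^[n] w, fiterate f θ n w x) := by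
  induction n generalizing w x with
  | zero => rfl
  | succ n ih => simp [Function.iterate_succ_apply, ih, fiterate]

theorem fiterate_add {Ω X : Type*} (f : Ω → X → X) (θ : Ω → Ω) (N j : ℕ) (w : Ω) (x : X) :
    fiterate f θ (N + j) w x = fiterate f θ j (θ^[N] w) (fiterate f θ N w x) := by
  induction N generalizing w x with
  | zero => simp [fiterate]
  | succ N ih => rw [Nat.add_right_comm]; simp [fiterate, ih]

theorem measurable_skew_iterate {Ω X : Type*} [MeasurableSpace Ω] [MeasurableSpace X]
    {f : Ω → X → X} {θ : Ω → Ω} (hF : Measurable fun p : Ω × X => (θ p.1, f p.1 p.2)) (n : ℕ) :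
    Measurable fun p : Ω × X => (θ^[n] p.1, fiterate f θ n p.1 p.2) := by
  simpa only [← iterate_skew] using hF.iterate n

theorem mem_GammaPlus_self {Ω X : Type*} [MetricSpace X] (f : Ω → X → X) (θ : Ω → Ω)
    {δ : Ω → ℝ} (hδ : ∀ w, 0 ≤ δ w) (w : Ω) (x : X) : x ∈ GammaPlus f θ δ w x :=
  fun n => by simpa using hδ _

theorem measurableSet_GammaPlus_graph {Ω X : Type*} [MeasurableSpace Ω] [MetricSpace X]
    [SecondCountableTopology X] [MeasurableSpace X] [BorelSpace X]
    {f : Ω → X → X} {θ : Ω → Ω} (hF : Measurable fun p : Ω × X => (θ p.1, f p.1 p.2)) (δ : ℝ) :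
    MeasurableSet {q : (Ω × X) × X | q.2 ∈ GammaPlus f θ (fun _ => δ) q.1.1 q.1.2} := by
  have heq : {q : (Ω × X) × X | q.2 ∈ GammaPlus f θ (fun _ => δ) q.1.1 q.1.2} =
      ⋂ n, {q | dist (fiterate f θ n q.1.1 q.1.2) (fiterate f θ n q.1.1 q.2) ≤ δ} := by
    ext q
    simp [GammaPlus]
  rw [heq]
  refine MeasurableSet.iInter fun n => ?_
  have h := measurable_snd.comp (measurable_skew_iterate hF n)
  have h1 : Measurable fun q : (Ω × X) × X => fiterate f θ n q.1.1 q.1.2 := h.comp measurable_fst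
  have h2 : Measurable fun q : (Ω × X) × X => fiterate f θ n q.1.1 q.2 :=
    h.comp ((measurable_fst.comp measurable_fst).prodMk measurable_snd)
  exact measurableSet_le (h1.dist h2) measurable_const

/-- Sets of measure at least `c` have a net of cardinality at most `1 / c` for the
intersection relation. -/
theorem exists_finset_inter_nonempty {X : Type*} [MeasurableSpace X]
    (ν : Measure X) [IsProbabilityMeasure ν] (Γ : X → Set X) (hΓ : ∀ x, MeasurableSet (Γ x))
    (hself : ∀ x, x ∈ Γ x) {c : ℝ} (hc : 0 < c) :
    ∃ D : Finset X, D.card ≤ ⌊1 / c⌋₊ ∧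
      ∀ x, c ≤ ν.real (Γ x) → ∃ d ∈ D, (Γ x ∩ Γ d).Nonempty := by
  classical
  let good : Finset X → Prop := fun D =>
    (D : Set X).PairwiseDisjoint Γ ∧ ∀ d ∈ D, c ≤ ν.real (Γ d)
  have hcard : ∀ D, good D → D.card ≤ ⌊1 / c⌋₊ := by
    rintro D ⟨hD, hDc⟩
    refine Nat.le_floor ?_
    rw [le_div_iff₀ hc]
    calc (D.card : ℝ) * c = ∑ d ∈ D, c := by simp
      _ ≤ ∑ d ∈ D, ν.real (Γ d) := Finset.sum_le_sum hDc
      _ = ν.real (⋃ d ∈ D, Γ d) := (measureReal_biUnion_finset hD fun d _ => hΓ d).symm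
      _ ≤ 1 := measureReal_le_one
  obtain ⟨D, hD, hmax⟩ : ∃ D, good D ∧ ∀ D', good D' → D'.card ≤ D.card := by
    have hbdd : BddAbove {k | ∃ D, good D ∧ D.card = k} :=
      ⟨⌊1 / c⌋₊, by rintro _ ⟨D, hD, rfl⟩; exact hcard D hD⟩
    have hne : {k | ∃ D, good D ∧ D.card = k}.Nonempty := ⟨0, ∅, by simp [good], by simp⟩
    obtain ⟨D, hD, hk⟩ := Nat.sSup_mem hne hbdd
    exact ⟨D, hD, fun D' hD' => hk ▸ le_csSup hbdd ⟨D', hD', rfl⟩⟩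
  refine ⟨D, hcard D hD, fun x hx => ?_⟩
  by_contra hcon
  push Not at hcon
  have hxD : x ∉ D := fun hxD => by
    have := hcon x hxD
    rw [Set.inter_self] at this
    exact Set.eq_empty_iff_forall_notMem.1 this x (hself x)
  have hgood : good (insert x D) := by
    refine ⟨?_, fun d hd => ?_⟩
    · rw [Finset.coe_insert]
      exact hD.1.insert fun d hd _ => Set.disjoint_iff_inter_eq_empty.2 (hcon d hd)
    · rcases Finset.mem_insert.1 hd with rfl | hd
      exacts [hx, hD.2 d hd]
  have := hmax _ hgood
  rw [Finset.card_insert_of_notMem hxD] at this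
  omega

/-! ### Itineraries are predictable when dynamical balls have positive measure -/

/-- If points close in a fiber and in `G` have the same label, then the itineraries of the points
whose orbit meets, before time `T`, a dynamical ball of measure at least `c` are described, up to
the visits to `Gᶜ`, by a bounded number of predictions. -/
theorem exists_predictions {Ω X : Type*} [MetricSpace X] [MeasurableSpace X]
    (κ : Ω → Measure X) [∀ w, IsProbabilityMeasure (κ w)]
    (f : Ω → X → X) (θ : Ω → Ω) {m : ℕ} (P : Fin m → Set (Ω × X))
    (hdisj : Pairwise (Function.onFun Disjoint P)) (hcov : ⋃ i, P i = Set.univ)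
    (G : Set (Ω × X)) {δ : ℝ} (hδ : 0 < δ)
    (hG : ∀ i w y y', (w, y) ∈ G → (w, y') ∈ G → dist y y' ≤ 4 * δ →
      (w, y) ∈ P i → (w, y') ∈ P i)
    (hΓ : ∀ w x, MeasurableSet (GammaPlus f θ (fun _ => δ) w x))
    {c : ℝ} (hc : 0 < c) (T : ℕ) (V : Set (Ω × X))
    (hV : ∀ w x, (w, x) ∈ V → ∃ N ≤ T, c ≤ (κ (θ^[N] w)).real
      (GammaPlus f θ (fun _ => δ) (θ^[N] w) (fiterate f θ N w x))) :
    ∃ M : ℕ, 0 < M ∧ ∀ w, ∃ Z : Finset (ℕ → Fin m), Z.card ≤ M ∧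
      ∀ x n, ∀ s : Fin n → Fin m, x ∈ cellSet f θ P w s → ∃ z ∈ Z,
        (∑ j : Fin n, if s j = z j then (0 : ℝ) else 1) ≤
          T + ∑ j : Fin n, Gᶜ.indicator 1 (θ^[(j : ℕ)] w, fiterate f θ j w x) +
            n * Vᶜ.indicator 1 (w, x) := by
  classical
  refine ⟨(T + 1) * ⌊1 / c⌋₊ + 1, Nat.succ_pos _, fun w => ?_⟩
  rcases isEmpty_or_nonempty X with hX | ⟨⟨x₀⟩⟩
  · exact ⟨∅, by simp, fun x => isEmptyElim x⟩
  have hlab : ∀ p, ∃ i, p ∈ P i := fun p => Set.mem_iUnion.1 (hcov ▸ Set.mem_univ p)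
  choose lab hlab using hlab
  choose D hDcard hD using fun v => exists_finset_inter_nonempty (κ v)
    (GammaPlus f θ (fun _ => δ) v) (hΓ v) (mem_GammaPlus_self f θ (fun _ => hδ.le) v) hc
  let C : ℕ → X → Set X := fun N d => {y | ∀ j,
    dist (fiterate f θ j (θ^[N] w) (fiterate f θ N w y)) (fiterate f θ j (θ^[N] w) d) ≤ 2 * δ}
  let z : ℕ → X → ℕ → Fin m := fun N d j =>
    if h : ∃ y ∈ C N d, (θ^[j] w, fiterate f θ j w y) ∈ G then
      lab (θ^[j] w, fiterate f θ j w h.choose) else lab (w, x₀)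
  have hz : ∀ N d x, x ∈ C N d → ∀ j, N ≤ j → (θ^[j] w, fiterate f θ j w x) ∈ G →
      (θ^[j] w, fiterate f θ j w x) ∈ P (z N d j) := by
    intro N d x hx j hj hxG
    have h : ∃ y ∈ C N d, (θ^[j] w, fiterate f θ j w y) ∈ G := ⟨x, hx, hxG⟩
    simp only [z, dif_pos h]
    refine hG _ _ _ _ h.choose_spec.2 hxG ?_ (hlab _)
    obtain ⟨k, rfl⟩ := Nat.exists_eq_add_of_le hj
    rw [fiterate_add, fiterate_add]
    have h1 := h.choose_spec.1 k
    have h2 := hx k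
    refine (dist_triangle_right _ _ (fiterate f θ k (θ^[N] w) d)).trans ?_
    linarith
  let Z : Finset (ℕ → Fin m) := insert (fun _ => lab (w, x₀))
    ((Finset.range (T + 1)).biUnion fun N => (D (θ^[N] w)).image (z N))
  refine ⟨Z, ?_, fun x n s hs => ?_⟩
  · refine (Finset.card_insert_le _ _).trans (Nat.succ_le_succ ?_)
    refine (Finset.card_biUnion_le_card_mul _ _ ⌊1 / c⌋₊ fun N _ =>
      Finset.card_image_le.trans (hDcard _)).trans ?_
    simp
  · have hind : ∀ p, (0 : ℝ) ≤ Gᶜ.indicator 1 p := fun p =>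
      Set.indicator_nonneg (fun _ _ => zero_le_one) _
    by_cases hxV : (w, x) ∈ V
    · obtain ⟨N, hNT, hN⟩ := hV w x hxV
      obtain ⟨d, hd, u, hux, hud⟩ := hD _ _ hN
      have hxC : x ∈ C N d := fun j => by
        have h1 := hux j
        have h2 := hud j
        refine (dist_triangle_right _ _ (fiterate f θ j (θ^[N] w) u)).trans ?_
        linarith
      refine ⟨z N d, Finset.mem_insert_of_mem (Finset.mem_biUnion.2
        ⟨N, Finset.mem_range.2 (Nat.lt_succ_of_le hNT), Finset.mem_image_of_mem _ hd⟩), ?_⟩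
      have hterm : ∀ j : Fin n, (if s j = z N d j then (0 : ℝ) else 1) ≤
          (if (j : ℕ) < T then 1 else 0) +
            Gᶜ.indicator 1 (θ^[(j : ℕ)] w, fiterate f θ j w x) := by
        intro j
        by_cases hjT : (j : ℕ) < T
        · rw [if_pos hjT]
          have := hind (θ^[(j : ℕ)] w, fiterate f θ j w x)
          split_ifs <;> linarith
        · rw [if_neg hjT, zero_add]
          by_cases hxG : (θ^[(j : ℕ)] w, fiterate f θ j w x) ∈ G
          · have h1 := hz N d x hxC j (hNT.trans (not_lt.1 hjT)) hxG
            have h2 : (θ^[(j : ℕ)] w, fiterate f θ j w x) ∈ P (s j) := Set.mem_iInter.1 hs j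
            have h3 : s j = z N d j := by
              by_contra hne
              exact Set.disjoint_left.1 (hdisj hne) h2 h1
            simpa [h3] using hind _
          · rw [Set.indicator_of_mem (by exact hxG)]
            split_ifs <;> simp
      have hT : (∑ j : Fin n, if (j : ℕ) < T then (1 : ℝ) else 0) ≤ T := by
        rw [Fin.sum_univ_eq_sum_range (fun j => if j < T then (1 : ℝ) else 0)]
        rw [Finset.sum_boole]
        have : ((Finset.range n).filter (· < T)).card ≤ (Finset.range T).card :=
          Finset.card_le_card fun j hj => Finset.mem_range.2 (Finset.mem_filter.1 hj).2
        rw [Finset.card_range] at this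
        exact_mod_cast this
      have hsum := Finset.sum_le_sum fun (j : Fin n) (_ : j ∈ Finset.univ) => hterm j
      rw [Finset.sum_add_distrib] at hsum
      have : (0 : ℝ) ≤ n * Vᶜ.indicator 1 (w, x) :=
        mul_nonneg n.cast_nonneg (Set.indicator_nonneg (fun _ _ => zero_le_one) _)
      linarith
    · refine ⟨_, Finset.mem_insert_self _ _, ?_⟩
      rw [Set.indicator_of_mem (s := Vᶜ) (by exact hxV)]
      have h1 : (∑ j : Fin n, if s j = lab (w, x₀) then (0 : ℝ) else 1) ≤ n := by
        refine (Finset.sum_le_sum (g := fun _ => (1 : ℝ))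
          fun j _ => by split_ifs <;> norm_num).trans ?_
        simp
      have h2 : (0 : ℝ) ≤ ∑ j : Fin n, Gᶜ.indicator 1 (θ^[(j : ℕ)] w, fiterate f θ j w x) :=
        Finset.sum_nonneg fun j _ => hind _
      have h3 : (0 : ℝ) ≤ T := T.cast_nonneg
      simp only [Pi.one_apply, mul_one]
      linarith

/-! ### The entropy estimate -/

section Cells

variable {Ω X : Type*} {f : Ω → X → X} {θ : Ω → Ω} {m : ℕ} {P : Fin m → Set (Ω × X)}

theorem measurableSet_cellSet [MeasurableSpace Ω] [MeasurableSpace X]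
    (hF : Measurable fun p : Ω × X => (θ p.1, f p.1 p.2)) (hP : ∀ i, MeasurableSet (P i)) (w : Ω) {n : ℕ} (s : Fin n → Fin m) :
    MeasurableSet (cellSet f θ P w s) :=
  .iInter fun j => ((measurable_skew_iterate hF j).comp measurable_prodMk_left) (hP (s j))

theorem pairwise_disjoint_cellSet (hP : Pairwise (Function.onFun Disjoint P)) (w : Ω) (n : ℕ) :
    Pairwise (Function.onFun Disjoint fun s : Fin n → Fin m => cellSet f θ P w s) := by
  intro s t hst
  obtain ⟨j, hj⟩ := Function.ne_iff.1 hst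
  refine Set.disjoint_left.2 fun x hx hx' => ?_
  exact Set.disjoint_left.1 (hP hj) (Set.mem_iInter.1 hx j) (Set.mem_iInter.1 hx' j)

theorem iUnion_cellSet (hP : ⋃ i, P i = Set.univ) (w : Ω) (n : ℕ) :
    ⋃ s : Fin n → Fin m, cellSet f θ P w s = Set.univ := by
  refine Set.eq_univ_of_forall fun x => ?_
  have hlab : ∀ p, ∃ i, p ∈ P i := fun p => Set.mem_iUnion.1 (hP ▸ Set.mem_univ p)
  choose lab hlab using hlab
  exact Set.mem_iUnion.2 ⟨fun j => lab (θ^[(j : ℕ)] w, fiterate f θ j w x),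
    Set.mem_iInter.2 fun j => hlab _⟩

end Cells

/-- If the fiber itineraries are described by `M` predictions up to `T` errors, the visits to
`Gᶜ`, and arbitrary errors on `Vᶜ`, then `fiberHn` grows at most linearly with small slope. -/
theorem fiberHn_le {Ω X : Type*} [MeasurableSpace Ω] [MeasurableSpace X]
    {ℙ : Measure Ω} [IsProbabilityMeasure ℙ]
    (κ : ProbabilityTheory.Kernel Ω X) [ProbabilityTheory.IsMarkovKernel κ]
    {f : Ω → X → X} {θ : Ω → Ω}
    (hF : MeasurePreserving (fun p : Ω × X => (θ p.1, f p.1 p.2))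
      (Measure.compProd ℙ κ) (Measure.compProd ℙ κ))
    {m : ℕ} {P : Fin m → Set (Ω × X)} (hP : ∀ i, MeasurableSet (P i))
    (hdisj : Pairwise (Function.onFun Disjoint P)) (hcov : ⋃ i, P i = Set.univ)
    {G V : Set (Ω × X)} (hG : MeasurableSet G) (hV : MeasurableSet V) {η : ℝ}
    (hGη : (Measure.compProd ℙ κ).real Gᶜ ≤ η) (hVη : (Measure.compProd ℙ κ).real Vᶜ ≤ η)
    {T M : ℕ} (hM : 0 < M)
    (hpred : ∀ w, ∃ Z : Finset (ℕ → Fin m), Z.card ≤ M ∧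
      ∀ x n, ∀ s : Fin n → Fin m, x ∈ cellSet f θ P w s → ∃ z ∈ Z,
        (∑ j : Fin n, if s j = z j then (0 : ℝ) else 1) ≤
          T + ∑ j : Fin n, Gᶜ.indicator 1 (θ^[(j : ℕ)] w, fiterate f θ j w x) +
            n * Vᶜ.indicator 1 (w, x))
    {τ : ℝ} (hτ : 0 < τ) (hτ1 : τ ≤ 1) (n : ℕ) :
    fiberHn ℙ κ f θ P n ≤
      Real.log M + n * (m * τ) + (-Real.log τ) * (T + n * (2 * η)) := by
  have hL : 0 ≤ -Real.log τ := by linarith [Real.log_nonpos hτ.le hτ1]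
  set μ := Measure.compProd ℙ κ with hμ
  have hFn : ∀ j, MeasurePreserving (fun p : Ω × X => (θ^[j] p.1, fiterate f θ j p.1 p.2)) μ μ := by
    intro j
    simpa only [← iterate_skew] using hF.iterate j
  let b : Ω × X → ℝ := fun p => T + ∑ j : Fin n,
    Gᶜ.indicator 1 (θ^[(j : ℕ)] p.1, fiterate f θ j p.1 p.2) + n * Vᶜ.indicator 1 p
  have hGi : Integrable (Gᶜ.indicator (1 : Ω × X → ℝ)) μ :=
    (integrable_const (1 : ℝ)).indicator hG.compl
  have hVi : Integrable (Vᶜ.indicator (1 : Ω × X → ℝ)) μ :=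
    (integrable_const (1 : ℝ)).indicator hV.compl
  have hGji : ∀ j, Integrable (fun p : Ω × X =>
      Gᶜ.indicator (1 : Ω × X → ℝ) (θ^[j] p.1, fiterate f θ j p.1 p.2)) μ := fun j =>
    (hFn j).integrable_comp_of_integrable hGi
  have hGj : ∀ j, ∫ p, Gᶜ.indicator (1 : Ω × X → ℝ) (θ^[j] p.1, fiterate f θ j p.1 p.2) ∂μ ≤ η := by
    intro j
    have h := integral_map (μ := μ) (hFn j).measurable.aemeasurable
      (f := Gᶜ.indicator (1 : Ω × X → ℝ)) (by rw [(hFn j).map_eq]; exact hGi.aestronglyMeasurable)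
    rw [(hFn j).map_eq, integral_indicator_one hG.compl] at h
    exact h ▸ hGη
  have hsumi : Integrable (fun p : Ω × X => ∑ j : Fin n,
      Gᶜ.indicator (1 : Ω × X → ℝ) (θ^[(j : ℕ)] p.1, fiterate f θ j p.1 p.2)) μ :=
    integrable_finsetSum _ fun j _ => hGji j
  have hb : Integrable b μ := ((integrable_const _).add hsumi).add (hVi.const_mul _)
  have hbint : ∫ p, b p ∂μ ≤ T + n * (2 * η) := by
    have h1 : ∫ p, b p ∂μ = T + ∑ j : Fin n, ∫ p, Gᶜ.indicator (1 : Ω × X → ℝ)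
        (θ^[(j : ℕ)] p.1, fiterate f θ j p.1 p.2) ∂μ + n * μ.real Vᶜ := by
      have e1 : ∫ p, b p ∂μ = ∫ p, ((T : ℝ) + ∑ j : Fin n, Gᶜ.indicator (1 : Ω × X → ℝ)
          (θ^[(j : ℕ)] p.1, fiterate f θ j p.1 p.2)) ∂μ + ∫ p, (n : ℝ) * Vᶜ.indicator 1 p ∂μ :=
        integral_add ((integrable_const _).add hsumi) (hVi.const_mul _)
      rw [e1, integral_add (integrable_const _) hsumi, integral_finsetSum _ fun (j : Fin n) _ => hGji j,
        integral_const_mul, integral_indicator_one hV.compl]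
      simp
    have h2 : ∑ j : Fin n, ∫ p, Gᶜ.indicator (1 : Ω × X → ℝ)
        (θ^[(j : ℕ)] p.1, fiterate f θ j p.1 p.2) ∂μ ≤ n * η := by
      refine (Finset.sum_le_sum fun (j : Fin n) _ => hGj j).trans ?_
      simp
    have h3 : (n : ℝ) * μ.real Vᶜ ≤ n * η := mul_le_mul_of_nonneg_left hVη n.cast_nonneg
    linarith
  let g : Ω × X → ℝ := fun p => Real.log M + n * (m * τ) + (-Real.log τ) * b p
  have hg : Integrable g μ := (integrable_const _).add (hb.const_mul _)
  have hgint : ∫ p, g p ∂μ = Real.log M + n * (m * τ) + (-Real.log τ) * ∫ p, b p ∂μ := by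
    rw [integral_add (integrable_const _) (hb.const_mul _), integral_const_mul]
    simp
  have hbfib := ((Measure.integrable_compProd_iff hb.aestronglyMeasurable).1 hb).1
  calc fiberHn ℙ κ f θ P n ≤ ∫ w, ∫ x, g (w, x) ∂κ w ∂ℙ := by
        refine integral_mono_of_nonneg (.of_forall fun w => Finset.sum_nonneg fun s _ =>
          Real.negMulLog_nonneg ENNReal.toReal_nonneg measureReal_le_one)
          hg.integral_compProd ?_
        filter_upwards [hbfib] with w hw
        obtain ⟨Z, hZ, hZp⟩ := hpred w
        exact sum_negMulLog_le_of_predictions (κ w) _ (measurableSet_cellSet hF.measurable hP w)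
          (pairwise_disjoint_cellSet hdisj w n) (iUnion_cellSet hcov w n) hτ hτ1 Z M hM hZ
          (fun x => b (w, x)) hw fun s x hx => hZp x n s hx
    _ = ∫ p, g p ∂μ := (Measure.integral_compProd hg).symm
    _ ≤ _ := by
        rw [hgint]
        gcongr

/-- In an ergodic system, a set of positive measure is visited before a bounded time off a set of
small measure. -/
theorem exists_bounded_hitting {α : Type*} [MeasurableSpace α] {μ : Measure α}
    [IsProbabilityMeasure μ] {F : α → α} (hF : Ergodic F μ) {A : Set α} (hA : MeasurableSet A)
    (hApos : μ A ≠ 0) {η : ENNReal} (hη : 0 < η) :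
    ∃ T : ℕ, μ (⋃ N, ⋃ (_ : N ≤ T), F^[N] ⁻¹' A)ᶜ ≤ η := by
  have hmeas : ∀ N, MeasurableSet (F^[N] ⁻¹' A) := fun N => (hF.measurable.iterate N) hA
  have hB : MeasurableSet (⋃ N, F^[N] ⁻¹' A) := .iUnion hmeas
  have hsub : F ⁻¹' (⋃ N, F^[N] ⁻¹' A) ⊆ ⋃ N, F^[N] ⁻¹' A := by
    intro p hp
    obtain ⟨N, hN⟩ := Set.mem_iUnion.1 hp
    exact Set.mem_iUnion.2 ⟨N + 1, hN⟩
  have huniv : (⋃ N, F^[N] ⁻¹' A) =ᵐ[μ] Set.univ := by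
    refine (hF.ae_empty_or_univ_of_preimage_ae_le hB.nullMeasurableSet
      (.of_forall hsub)).resolve_left fun h => hApos ?_
    rw [ae_eq_empty] at h
    exact measure_mono_null (Set.subset_iUnion (fun N => F^[N] ⁻¹' A) 0) h
  have hzero : μ (⋃ N, F^[N] ⁻¹' A)ᶜ = 0 := by
    rw [prob_compl_eq_zero_iff hB, measure_congr huniv, measure_univ]
  have hacc : ∀ T, MeasurableSet (⋃ N, ⋃ (_ : N ≤ T), F^[N] ⁻¹' A) := fun T =>
    .iUnion fun N => .iUnion fun _ => hmeas N
  have ht : Tendsto (fun T : ℕ => μ (⋃ N, ⋃ (_ : N ≤ T), F^[N] ⁻¹' A)ᶜ) atTop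
      (nhds (μ (⋂ T : ℕ, (⋃ N, ⋃ (_ : N ≤ T), F^[N] ⁻¹' A)ᶜ))) := by
    refine tendsto_measure_iInter_atTop (fun T => (hacc T).compl.nullMeasurableSet)
      (fun a b hab => ?_) ⟨0, measure_ne_top _ _⟩
    exact Set.compl_subset_compl.2 (Set.iUnion_mono fun N =>
      Set.iUnion_subset fun hN => Set.subset_iUnion_of_subset (hN.trans hab) le_rfl)
  have heq : ⋂ T : ℕ, (⋃ N, ⋃ (_ : N ≤ T), F^[N] ⁻¹' A)ᶜ = (⋃ N, F^[N] ⁻¹' A)ᶜ := by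
    rw [← Set.compl_iUnion]
    congr 1
    ext p
    simp only [Set.mem_iUnion]
    exact ⟨fun ⟨_, N, _, h⟩ => ⟨N, h⟩, fun ⟨N, h⟩ => ⟨N, N, le_rfl, h⟩⟩
  rw [heq, hzero] at ht
  exact ((ht.eventually_lt_const hη).exists).imp fun T h => h.le

theorem exists_pos_eventually_le_of_liminf_pos {u : ℕ → ℝ} (h : 0 < liminf u atTop) :
    ∃ a > 0, ∀ᶠ n in atTop, a ≤ u n := by
  by_contra! hcon
  refine h.not_ge ?_
  rw [liminf_eq]
  refine Real.sSup_nonpos fun a ha => ?_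
  by_contra! hapos
  obtain ⟨n, hn, hn'⟩ := ((hcon a hapos).and_eventually ha).exists
  exact (hn.trans_le hn').false

/-- Positive fiber entropy forces the dynamical balls at some constant scale to be null almost
everywhere. -/
theorem exists_ae_measure_GammaPlus_eq_zero {Ω X : Type*} [MeasurableSpace Ω] [MetricSpace X]
    [SecondCountableTopology X] [MeasurableSpace X] [BorelSpace X]
    {ℙ : Measure Ω} [IsProbabilityMeasure ℙ]
    (κ : ProbabilityTheory.Kernel Ω X) [ProbabilityTheory.IsMarkovKernel κ]
    {f : Ω → X → X} {θ : Ω → Ω}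
    (hF : Ergodic (fun p : Ω × X => (θ p.1, f p.1 p.2)) (Measure.compProd ℙ κ))
    {m : ℕ} {P : Fin m → Set (Ω × X)} (hP : ∀ i, MeasurableSet (P i))
    (hdisj : Pairwise (Function.onFun Disjoint P)) (hcov : ⋃ i, P i = Set.univ)
    (hent : 0 < fiberEntropyOfPartition ℙ κ f θ P) :
    ∃ δ : ℝ, 0 < δ ∧ ∀ᵐ w ∂ℙ, ∀ᵐ x ∂κ w, κ w (GammaPlus f θ (fun _ => δ) w x) = 0 := by
  obtain ⟨a, ha, hev⟩ := exists_pos_eventually_le_of_liminf_pos hent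
  obtain ⟨τ, hτ, hτ1, hmτ⟩ : ∃ τ : ℝ, 0 < τ ∧ τ ≤ 1 ∧ m * τ ≤ a / 4 := by
    refine ⟨min 1 (a / 4 / (m + 1)), by positivity, min_le_left _ _, ?_⟩
    calc (m : ℝ) * min 1 (a / 4 / (m + 1)) ≤ (m + 1) * (a / 4 / (m + 1)) := by
          gcongr
          · linarith
          · exact min_le_right _ _
      _ = a / 4 := by field_simp
  set L := -Real.log τ with hLdef
  have hL : 0 ≤ L := by linarith [Real.log_nonpos hτ.le hτ1]
  obtain ⟨η, hη, hLη⟩ : ∃ η : ℝ, 0 < η ∧ L * (2 * η) ≤ a / 4 := by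
    refine ⟨a / 8 / (L + 1), by positivity, ?_⟩
    rw [show L * (2 * (a / 8 / (L + 1))) = a / 4 * (L / (L + 1)) by ring]
    have : L / (L + 1) ≤ 1 := (div_le_one (by positivity)).2 (by linarith)
    nlinarith
  set μ := Measure.compProd ℙ κ with hμ
  have hreal : ∀ S : Set (Ω × X), μ S ≤ ENNReal.ofReal η → μ.real S ≤ η := fun S hS =>
    ENNReal.toReal_le_of_le_ofReal hη.le hS
  obtain ⟨G, hG, hGη, δ', hδ', hGδ⟩ := AlmostLocallyConstant.exists_common (μ := μ)
    (fun i => AlmostLocallyConstant.of_measurableSet (hP i)) (ENNReal.ofReal_pos.2 hη)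
  obtain ⟨δ, hδ, rfl⟩ : ∃ δ : ℝ, 0 < δ ∧ δ' = 4 * δ := ⟨δ' / 4, by positivity, by ring⟩
  refine ⟨δ, hδ, ?_⟩
  have hgraph := measurableSet_GammaPlus_graph hF.measurable δ
  have hΓ : ∀ w x, MeasurableSet (GammaPlus f θ (fun _ => δ) w x) := fun w x =>
    measurable_prodMk_left (x := (w, x)) hgraph
  let φ : Ω × X → ENNReal := fun p => κ p.1 (GammaPlus f θ (fun _ => δ) p.1 p.2)
  have hφ : Measurable φ := ProbabilityTheory.Kernel.measurable_kernel_prodMk_left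
    (κ := κ.comap Prod.fst measurable_fst) hgraph
  suffices h : ∀ᵐ p ∂μ, φ p = 0 from Measure.ae_ae_of_ae_compProd h
  by_contra hcon
  obtain ⟨k, hk⟩ : ∃ k : ℕ, μ {p | ENNReal.ofReal (1 / (k + 1)) ≤ φ p} ≠ 0 := by
    by_contra! hall
    refine hcon ?_
    rw [ae_iff]
    refine measure_mono_null (fun p hp => ?_) (measure_iUnion_null hall)
    obtain ⟨k, hk⟩ := exists_nat_one_div_lt (ENNReal.toReal_pos hp (measure_ne_top _ _))
    exact Set.mem_iUnion.2 ⟨k, ENNReal.ofReal_le_of_le_toReal hk.le⟩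
  set A := {p | ENNReal.ofReal (1 / ((k : ℝ) + 1)) ≤ φ p} with hA
  have hAmeas : MeasurableSet A := measurableSet_le measurable_const hφ
  obtain ⟨T, hT⟩ := exists_bounded_hitting hF hAmeas hk (ENNReal.ofReal_pos.2 hη)
  set V := ⋃ N, ⋃ (_ : N ≤ T), (fun p : Ω × X => (θ p.1, f p.1 p.2))^[N] ⁻¹' A with hV
  have hVmeas : MeasurableSet V :=
    .iUnion fun N => .iUnion fun _ => (hF.measurable.iterate N) hAmeas
  obtain ⟨M, hM, hpred⟩ := exists_predictions (fun w => κ w) f θ P hdisj hcov G hδ hGδ hΓ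
    (c := 1 / ((k : ℝ) + 1)) (by positivity) T V (by
      intro w x hx
      simp only [hV, Set.mem_iUnion] at hx
      obtain ⟨N, hN, hx⟩ := hx
      rw [Set.mem_preimage, iterate_skew] at hx
      exact ⟨N, hN, (ENNReal.ofReal_le_iff_le_toReal (measure_ne_top _ _)).1 hx⟩)
  have hbound := fiberHn_le κ hF.toMeasurePreserving hP hdisj hcov hG hVmeas (hreal _ hGη)
    (hreal _ hT) hM hpred hτ hτ1
  have hlim : Tendsto (fun n : ℕ => (Real.log M + L * T) / (n : ℝ)) atTop (nhds 0) :=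
    tendsto_const_div_atTop_nhds_zero_nat _
  obtain ⟨n, ⟨hn1, hn2⟩, hn0⟩ := ((hev.and (hlim.eventually_lt_const (show 0 < a / 4 by positivity))).and
    (eventually_gt_atTop 0)).exists
  have hnr : (0 : ℝ) < n := by exact_mod_cast hn0
  rw [le_div_iff₀ hnr] at hn1
  rw [div_lt_iff₀ hnr] at hn2
  have h1 := hbound n
  have h2 := mul_le_mul_of_nonneg_left hmτ hnr.le
  have h3 := mul_le_mul_of_nonneg_left hLη hnr.le
  nlinarith

theorem exists_partition_of_fiberEntropy_pos {Ω X : Type*} [MeasurableSpace Ω] [MeasurableSpace X]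
    {ℙ : Measure Ω} {μ : Ω → Measure X} {f : Ω → X → X} {θ : Ω → Ω}
    (h : 0 < fiberEntropy ℙ μ f θ) :
    ∃ (m : ℕ) (P : Fin m → Set (Ω × X)), ((∀ i, MeasurableSet (P i)) ∧
      Pairwise (Function.onFun Disjoint P) ∧ (⋃ i, P i) = Set.univ) ∧
      0 < fiberEntropyOfPartition ℙ μ f θ P := by
  by_contra! hcon
  exact h.not_ge (Real.iSup_nonpos fun m => Real.iSup_nonpos fun P =>
    Real.iSup_nonpos fun hP => hcon m P hP)

/-- If almost every dynamical ball at scale `δ` is null, then every one at scale `δ / 2` is. -/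
theorem measure_GammaPlus_half_eq_zero {Ω X : Type*} [MetricSpace X] [MeasurableSpace X]
    {ν : Measure X} {f : Ω → X → X} {θ : Ω → Ω} {δ : ℝ} {w : Ω}
    (h : ∀ᵐ x ∂ν, ν (GammaPlus f θ (fun _ => δ) w x) = 0) (x : X) :
    ν (GammaPlus f θ (fun _ => δ / 2) w x) = 0 := by
  by_contra hne
  obtain ⟨y, hy, hy0⟩ := (frequently_ae_mem_iff.2 hne).and_eventually h |>.exists
  have hsub : GammaPlus f θ (fun _ => δ / 2) w x ⊆ GammaPlus f θ (fun _ => δ) w y := by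
    intro z hz n
    have h1 := hy n
    have h2 := hz n
    refine (dist_triangle_left _ _ (fiterate f θ n w x)).trans ?_
    linarith
  exact hne (measure_mono_null hsub hy0)

/-- Theorem A (1): an ergodic invariant measure with positive fiber entropy is
positively random expansive. -/
theorem stmt_14 {Ω X : Type*} [MeasurableSpace Ω] [MetricSpace X] [CompactSpace X]
    [MeasurableSpace X] [BorelSpace X]
    (ℙ : Measure Ω) [IsProbabilityMeasure ℙ]
    (θ : Equiv.Perm Ω) (hθ : MeasurePreserving θ ℙ ℙ)
    (f : Ω → X → X) (hfcont : ∀ w, Continuous (f w))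
    (μ : Ω → Measure X) (hμprob : ∀ w, IsProbabilityMeasure (μ w))
    (μtot : Measure (Ω × X)) (hμtotprob : IsProbabilityMeasure μtot)
    (hmarg : μtot.map Prod.fst = ℙ)
    (hdisint : ∀ s : Set (Ω × X), MeasurableSet s →
      μtot s = ∫⁻ w, μ w (Prod.mk w ⁻¹' s) ∂ℙ)
    (herg : Ergodic (fun p : Ω × X => (θ p.1, f p.1 p.2)) μtot)
    (hent : 0 < fiberEntropy ℙ μ f (⇑θ)) :
    ∃ δ : Ω → ℝ, Measurable δ ∧ (∀ w, 0 < δ w) ∧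
      ∀ᵐ w ∂ℙ, ∀ x : X, μ w (GammaPlus f (⇑θ) δ w x) = 0 := by
  have hX : Nonempty X := by
    obtain ⟨p⟩ := μtot.nonempty_of_neZero
    exact ⟨p.2⟩
  have hae := ae_eq_condKernel_of_disintegration ℙ μ hμprob μtot hmarg hdisint
  have hdis : Measure.compProd ℙ μtot.condKernel = μtot := by
    rw [← show μtot.fst = ℙ from hmarg]
    exact μtot.disintegrate _
  obtain ⟨m, P, ⟨hP, hdisj, hcov⟩, hPent⟩ := exists_partition_of_fiberEntropy_pos hent
  have hHn : ∀ n, fiberHn ℙ μ f θ P n = fiberHn ℙ μtot.condKernel f θ P n := fun n =>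
    integral_congr_ae (hae.mono fun w hw => by simp only [hw])
  have hPent' : 0 < fiberEntropyOfPartition ℙ μtot.condKernel f θ P := by
    simpa only [fiberEntropyOfPartition, hHn] using hPent
  obtain ⟨δ, hδ, hnull⟩ := exists_ae_measure_GammaPlus_eq_zero (ℙ := ℙ) μtot.condKernel
    (by rwa [hdis]) hP hdisj hcov hPent'
  refine ⟨fun _ => δ / 2, measurable_const, fun _ => by positivity, ?_⟩
  filter_upwards [hae, hnull] with w hw hwnull x
  rw [hw]
  exact measure_GammaPlus_half_eq_zero hwnull x
end
end

section
/- Let f = {f_w} be a random dynamical system and μ ∈ M(E, f) ergodic with positive fiber entropy h_μ(f) > 0. Then for ℙ-a.e. w, every w-stable class W_w^s(p) = {x ∈ E_w : d(f_wⁿ(x), f_wⁿ(p)) → 0} has μ_w-measure zero. -/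
open MeasureTheory Filter

noncomputable section

/-- The `w`-stable set of `p ∈ E_w`. -/
def wStable {Ω X : Type*} [MetricSpace X] (f : Ω → X → X) (θ : Ω → Ω)
    (w : Ω) (p : X) : Set X :=
  {x : X | Tendsto (fun n => dist (fiterate f θ n w x) (fiterate f θ n w p))
    atTop (nhds 0)}

section FiberEntropy

open ProbabilityTheory Topology

/-- A family of probability measures with the disintegration property of a Markov kernel agrees
with it almost everywhere; no measurability of the family is assumed. -/
theorem ae_eq_kernel_of_lintegral_eq {Ω X : Type*} [MeasurableSpace Ω] [MeasurableSpace X]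
    [StandardBorelSpace X] {ρ : Measure Ω} [IsProbabilityMeasure ρ] {μ : Ω → Measure X}
    (hμ : ∀ w, IsProbabilityMeasure (μ w)) (κ : Kernel Ω X) [IsMarkovKernel κ]
    (h : ∀ s : Set (Ω × X), MeasurableSet s →
      ∫⁻ w, μ w (Prod.mk w ⁻¹' s) ∂ρ = ∫⁻ w, κ w (Prod.mk w ⁻¹' s) ∂ρ) :
    ∀ᵐ w ∂ρ, μ w = κ w := by
  have hset : ∀ A : Set Ω, MeasurableSet A → ∀ B : Set X, MeasurableSet B →
      ∫⁻ w in A, μ w B ∂ρ = ∫⁻ w in A, κ w B ∂ρ := by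
    intro A hA B hB
    have hpre : ∀ ν : Ω → Measure X, ∀ w,
        ν w (Prod.mk w ⁻¹' (A ×ˢ B)) = A.indicator (fun w => ν w B) w := by
      intro ν w
      by_cases hw : w ∈ A <;> simp [hw]
    have key := h _ (hA.prod hB)
    rw [lintegral_congr (hpre μ), lintegral_congr (hpre κ), lintegral_indicator hA,
      lintegral_indicator hA] at key
    exact key
  have hle : ∀ B : Set X, MeasurableSet B → ∀ᵐ w ∂ρ, κ w B ≤ μ w B := by
    intro B hB
    obtain ⟨g, hg, hgle, hgint⟩ := exists_measurable_le_lintegral_eq ρ (fun w => μ w B)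
    have hgκ : g ≤ᵐ[ρ] fun w => κ w B := by
      refine ae_le_of_forall_setLIntegral_le_of_sigmaFinite hg fun A hA _ => ?_
      rw [← hset A hA B hB]
      exact lintegral_mono hgle
    have htot : ∫⁻ w, μ w B ∂ρ = ∫⁻ w, κ w B ∂ρ := by
      simpa using hset Set.univ MeasurableSet.univ B hB
    have hfin : ∫⁻ w, κ w B ∂ρ ≠ ⊤ := by
      refine ne_top_of_le_ne_top ENNReal.one_ne_top ?_
      calc ∫⁻ w, κ w B ∂ρ ≤ ∫⁻ _, 1 ∂ρ := lintegral_mono fun w => prob_le_one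
        _ = 1 := by simp
    have heq := ae_eq_of_ae_le_of_lintegral_le hgκ (by rwa [← hgint, htot])
      (κ.measurable_coe hB).aemeasurable (by rw [← htot, hgint])
    filter_upwards [heq] with w hw
    rw [← hw]
    exact hgle w
  have heq : ∀ B : Set X, MeasurableSet B → ∀ᵐ w ∂ρ, μ w B = κ w B := by
    intro B hB
    filter_upwards [hle B hB, hle Bᶜ hB.compl] with w h1 h2
    refine le_antisymm ?_ h1
    have := hμ w
    rw [prob_compl_eq_one_sub hB, prob_compl_eq_one_sub hB] at h2
    exact (ENNReal.sub_le_sub_iff_left prob_le_one ENNReal.one_ne_top).1 h2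
  have hemb := measurableEmbedding_embeddingReal X
  suffices ∀ᵐ w ∂ρ, ∀ ⦃t⦄, MeasurableSet t → μ w t = κ w t by
    filter_upwards [this] with w hw
    ext t ht
    exact hw ht
  refine MeasurableSpace.ae_induction_on_inter
    (s := {s | ∃ t ∈ ⋃ a : ℚ, {Set.Iic (a : ℝ)}, embeddingReal X ⁻¹' t = s}) ?_
    (Real.isPiSystem_Iic_rat.comap _) (by simp) ?_ ?_ ?_
  · refine hemb.comap_eq.symm.trans ?_
    rw [BorelSpace.measurable_eq (α := ℝ), Real.borel_eq_generateFrom_Iic_rat,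
      MeasurableSpace.comap_generateFrom]
    rfl
  · have := ae_all_iff.2 fun q : ℚ =>
      heq (embeddingReal X ⁻¹' Set.Iic (q : ℝ)) (hemb.measurable measurableSet_Iic)
    filter_upwards [this] with w hw
    rintro _ ⟨t, ht, rfl⟩
    obtain ⟨q, rfl⟩ := Set.mem_iUnion.1 ht
    exact hw q
  · refine ae_of_all _ fun w t ht h' => ?_
    have := hμ w
    rw [prob_compl_eq_one_sub ht, prob_compl_eq_one_sub ht, h']
  · refine ae_of_all _ fun w f hd hf h' => ?_
    rw [measure_iUnion hd hf, measure_iUnion hd hf]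
    exact tsum_congr h'

/-- Let `U j` and `V j` be random points of `Ω × X` with the same base point, whose laws are
dominated by a fixed finite measure and whose fiber distance tends to zero. Then every measurable
set asymptotically fails to separate `U j` from `V j`. -/
theorem tendsto_measure_separated {Ω X Z : Type*} [MeasurableSpace Ω] [MeasurableSpace Z]
    [MetricSpace X] [MeasurableSpace X] [BorelSpace X] [SecondCountableTopology X]
    {l : Measure Z} [IsFiniteMeasure l] {ρ : Measure (Ω × X)} [IsFiniteMeasure ρ]
    {U V : ℕ → Z → Ω × X} (hU : ∀ j, Measurable (U j)) (hV : ∀ j, Measurable (V j))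
    (hUρ : ∀ j T, MeasurableSet T → l (U j ⁻¹' T) ≤ ρ T)
    (hVρ : ∀ j T, MeasurableSet T → l (V j ⁻¹' T) ≤ ρ T)
    (hfst : ∀ j z, (U j z).1 = (V j z).1)
    (hdist : ∀ᵐ z ∂l, Tendsto (fun j => dist (U j z).2 (V j z).2) atTop (𝓝 0))
    {S : Set (Ω × X)} (hS : MeasurableSet S) :
    Tendsto (fun j => l {z | ¬ (U j z ∈ S ↔ V j z ∈ S)}) atTop (𝓝 0) := by
  let good : Set (Ω × X) → Prop := fun S => MeasurableSet S ∧
    Tendsto (fun j => l {z | ¬ (U j z ∈ S ↔ V j z ∈ S)}) atTop (𝓝 0)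
  have hcompl : ∀ S, good S → good Sᶜ := fun S hS =>
    ⟨hS.1.compl, by simpa only [Set.mem_compl_iff, not_iff_not] using hS.2⟩
  have hunion : ∀ S : ℕ → Set (Ω × X), (∀ k, good (S k)) → good (⋃ k, S k) := by
    intro S hS
    have hm : MeasurableSet (⋃ k, S k) := MeasurableSet.iUnion fun k => (hS k).1
    refine ⟨hm, ENNReal.tendsto_nhds_zero.2 fun ε hε => ?_⟩
    let T : ℕ → Set (Ω × X) := fun K => (⋃ k, S k) \ Set.accumulate S K
    have hacc : ∀ K, MeasurableSet (Set.accumulate S K) := fun K =>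
      MeasurableSet.biUnion (Set.to_countable _) fun k _ => (hS k).1
    have hTm : ∀ K, MeasurableSet (T K) := fun K => hm.diff (hacc K)
    have hT : Tendsto (fun K => ρ (T K)) atTop (𝓝 0) := by
      have h0 : ⋂ K, T K = ∅ := by
        simp only [T, ← Set.sdiff_iUnion, Set.iUnion_accumulate, Set.sdiff_self]
      rw [← measure_empty (μ := ρ), ← h0]
      refine tendsto_measure_iInter_atTop (fun K => (hTm K).nullMeasurableSet) ?_
        ⟨0, measure_ne_top _ _⟩
      exact fun a b hab => Set.sdiff_subset_sdiff_right (Set.monotone_accumulate hab)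
    have hε3 : 0 < ε / 3 := ENNReal.div_pos hε.ne' (by simp)
    obtain ⟨K, hK⟩ := (ENNReal.tendsto_nhds_zero.1 hT (ε / 3) hε3).exists
    have hsum : Tendsto (fun j => ∑ k ∈ Finset.range (K + 1),
        l {z | ¬ (U j z ∈ S k ↔ V j z ∈ S k)}) atTop (𝓝 0) := by
      simpa using tendsto_finsetSum (Finset.range (K + 1)) fun k _ => (hS k).2
    filter_upwards [ENNReal.tendsto_nhds_zero.1 hsum (ε / 3) hε3] with j hj
    have hsub : {z | ¬ (U j z ∈ ⋃ k, S k ↔ V j z ∈ ⋃ k, S k)} ⊆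
        (⋃ k ∈ Finset.range (K + 1), {z | ¬ (U j z ∈ S k ↔ V j z ∈ S k)}) ∪
          (U j ⁻¹' T K ∪ V j ⁻¹' T K) := by
      intro z hz
      by_contra hcon
      simp only [Set.mem_union, not_or, Set.mem_iUnion, not_exists, Set.mem_ofPred_eq,
        not_not, Finset.mem_range, Set.mem_preimage, T, Set.mem_sdiff, not_and,
        Set.mem_accumulate, Nat.lt_succ_iff] at hcon hz
      obtain ⟨h1, h2, h3⟩ := hcon
      apply hz
      constructor
      · intro hu
        by_contra hn
        exact h2 hu fun k hk hk' => hn ⟨k, (h1 k hk).1 hk'⟩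
      · intro hv
        by_contra hn
        exact h3 hv fun k hk hk' => hn ⟨k, (h1 k hk).2 hk'⟩
    calc l {z | ¬ (U j z ∈ ⋃ k, S k ↔ V j z ∈ ⋃ k, S k)}
        ≤ ∑ k ∈ Finset.range (K + 1), l {z | ¬ (U j z ∈ S k ↔ V j z ∈ S k)}
          + (ρ (T K) + ρ (T K)) := by
          refine (measure_mono hsub).trans ((measure_union_le _ _).trans ?_)
          refine add_le_add (measure_biUnion_finset_le _ _) ((measure_union_le _ _).trans ?_)
          exact add_le_add (hUρ j _ (hTm K)) (hVρ j _ (hTm K))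
      _ ≤ ε / 3 + (ε / 3 + ε / 3) := by gcongr
      _ = ε := by rw [← add_assoc, ENNReal.add_thirds]
  have hclosed : ∀ K : Set X, IsClosed K → good (Prod.snd ⁻¹' K) := by
    intro K hK
    refine ⟨measurable_snd hK.measurableSet, ENNReal.tendsto_nhds_zero.2 fun ε hε => ?_⟩
    have hε3 : 0 < ε / 3 := ENNReal.div_pos hε.ne' (by simp)
    let T : ℝ → Set (Ω × X) := fun r => Prod.snd ⁻¹' (Metric.thickening r K \ K)
    have hTm : ∀ r, MeasurableSet (T r) := fun r =>
      measurable_snd (Metric.isOpen_thickening.measurableSet.diff hK.measurableSet)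
    have hT : Tendsto (fun r => ρ (T r)) (𝓝[>] 0) (𝓝 0) := by
      have h1 := tendsto_measure_thickening_of_isClosed (μ := ρ.map Prod.snd) (s := K)
        ⟨1, one_pos, measure_ne_top _ _⟩ hK
      have h2 := ENNReal.Tendsto.sub h1 (tendsto_const_nhds (x := ρ.map Prod.snd K))
        (Or.inl (measure_ne_top _ _))
      rw [tsub_self] at h2
      refine h2.congr' ?_
      filter_upwards [self_mem_nhdsWithin] with r hr
      rw [← measure_sdiff (Metric.self_subset_thickening hr K) hK.measurableSet.nullMeasurableSet
        (measure_ne_top _ _), Measure.map_apply measurable_snd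
        (Metric.isOpen_thickening.measurableSet.diff hK.measurableSet)]
    obtain ⟨r, hr, hr0⟩ :=
      ((ENNReal.tendsto_nhds_zero.1 hT (ε / 3) hε3).and self_mem_nhdsWithin).exists
    have hfar : Tendsto (fun j => l {z | r ≤ dist (U j z).2 (V j z).2}) atTop (𝓝 0) := by
      have := tendstoInMeasure_of_tendsto_ae (μ := l)
        (f := fun j z => dist (U j z).2 (V j z).2) (g := fun _ => (0 : ℝ))
        (fun j => ((hU j).snd.dist (hV j).snd).aestronglyMeasurable) hdist
      have := tendstoInMeasure_iff_dist.1 this r hr0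
      simpa [abs_of_nonneg] using this
    filter_upwards [ENNReal.tendsto_nhds_zero.1 hfar (ε / 3) hε3] with j hj
    have hsub : {z | ¬ (U j z ∈ Prod.snd ⁻¹' K ↔ V j z ∈ Prod.snd ⁻¹' K)} ⊆
        {z | r ≤ dist (U j z).2 (V j z).2} ∪ (U j ⁻¹' T r ∪ V j ⁻¹' T r) := by
      intro z hz
      by_contra hcon
      simp only [Set.mem_union, not_or, Set.mem_ofPred_eq, not_le, Set.mem_preimage, T,
        Set.mem_sdiff, not_and, not_not] at hcon hz
      obtain ⟨h1, h2, h3⟩ := hcon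
      apply hz
      constructor
      · intro hu
        exact h3 (Metric.mem_thickening_iff.2 ⟨_, hu, by rwa [dist_comm]⟩)
      · intro hv
        exact h2 (Metric.mem_thickening_iff.2 ⟨_, hv, h1⟩)
    calc l {z | ¬ (U j z ∈ Prod.snd ⁻¹' K ↔ V j z ∈ Prod.snd ⁻¹' K)}
        ≤ l {z | r ≤ dist (U j z).2 (V j z).2} + (ρ (T r) + ρ (T r)) := by
          refine (measure_mono hsub).trans ((measure_union_le _ _).trans ?_)
          refine add_le_add le_rfl ((measure_union_le _ _).trans ?_)
          exact add_le_add (hUρ j _ (hTm r)) (hVρ j _ (hTm r))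
      _ ≤ ε / 3 + (ε / 3 + ε / 3) := by gcongr
      _ = ε := by rw [← add_assoc, ENNReal.add_thirds]
  let goodSpace : MeasurableSpace (Ω × X) := ⟨good, by simp [good], hcompl, hunion⟩
  have hle : (Prod.instMeasurableSpace : MeasurableSpace (Ω × X)) ≤ goodSpace := by
    refine sup_le ?_ ?_
    · rintro _ ⟨A, hA, rfl⟩
      exact ⟨measurable_fst hA, by simp [hfst]⟩
    · rw [MeasurableSpace.comap_le_iff_le_map, BorelSpace.measurable_eq (α := X),
        borel_eq_generateFrom_isClosed]
      exact MeasurableSpace.generateFrom_le fun K hK => hclosed K hK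
  exact (hle S hS).2

theorem sum_negMulLog_le_sum_mul_neg_log {ι : Type*} [Fintype ι] {p q : ι → ℝ}
    (hp : ∀ i, 0 ≤ p i) (hp1 : ∑ i, p i = 1) (hq : ∀ i, 0 < q i) (hq1 : ∑ i, q i ≤ 1) :
    ∑ i, Real.negMulLog (p i) ≤ ∑ i, p i * -Real.log (q i) := by
  have hterm : ∀ i, Real.negMulLog (p i) - p i * -Real.log (q i) ≤ q i - p i := by
    intro i
    rcases (hp i).eq_or_lt with h | h
    · simp [← h, (hq i).le]
    · have hlog := Real.log_le_sub_one_of_pos (div_pos (hq i) h)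
      rw [Real.log_div (hq i).ne' h.ne'] at hlog
      have hmul := mul_le_mul_of_nonneg_left hlog h.le
      have hcancel : p i * (q i / p i - 1) = q i - p i := by field_simp
      rw [hcancel] at hmul
      rw [Real.negMulLog]
      linarith
  have hsum := Finset.sum_le_sum fun i (_ : i ∈ Finset.univ) => hterm i
  simp only [Finset.sum_sub_distrib, hp1] at hsum
  linarith

/-- Number of coordinates in which two words differ, as a real number. -/
def mismatch {n m : ℕ} (s t : Fin n → Fin m) : ℝ :=
  ∑ j, if s j ≠ t j then 1 else 0

theorem mismatch_nonneg {n m : ℕ} (s t : Fin n → Fin m) : 0 ≤ mismatch s t :=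
  Finset.sum_nonneg fun j _ => by split_ifs <;> simp

theorem mismatch_le {n m : ℕ} (s t : Fin n → Fin m) : mismatch s t ≤ n := by
  calc mismatch s t ≤ ∑ _j : Fin n, (1 : ℝ) :=
        Finset.sum_le_sum fun j _ => by split_ifs <;> simp
    _ = n := by simp

theorem sum_exp_neg_mismatch_le_one {n m : ℕ} {α L : ℝ}
    (hαL : Real.exp (-α) * (1 + m * Real.exp (-L)) ≤ 1) (t : Fin n → Fin m) :
    ∑ s : Fin n → Fin m, Real.exp (-(α * n + L * mismatch s t)) ≤ 1 := by
  have hprod : ∀ s : Fin n → Fin m, Real.exp (-(α * n + L * mismatch s t)) =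
      ∏ j, Real.exp (-(α + L * if s j ≠ t j then 1 else 0)) := by
    intro s
    rw [← Real.exp_sum]
    congr 1
    simp only [mismatch, Finset.sum_neg_distrib, Finset.sum_add_distrib, Finset.mul_sum,
      Finset.sum_const, Finset.card_univ, Fintype.card_fin, nsmul_eq_mul]
    ring
  rw [Finset.sum_congr rfl fun s _ => hprod s,
    ← Fintype.prod_sum fun j a => Real.exp (-(α + L * if a ≠ t j then 1 else 0))]
  refine Finset.prod_le_one (fun j _ => Finset.sum_nonneg fun a _ => (Real.exp_pos _).le)
    fun j _ => ?_
  refine le_trans ?_ hαL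
  calc ∑ a : Fin m, Real.exp (-(α + L * if a ≠ t j then 1 else 0))
      ≤ ∑ a : Fin m, Real.exp (-α) * ((if a = t j then 1 else 0) + Real.exp (-L)) := by
        refine Finset.sum_le_sum fun a _ => ?_
        by_cases h : a = t j
        · simp only [h, ne_eq, not_true_eq_false, if_false, if_true, mul_zero, add_zero]
          exact le_mul_of_one_le_right (Real.exp_pos _).le (by linarith [Real.exp_pos (-L)])
        · simp [h, ← Real.exp_add, add_comm]
    _ = Real.exp (-α) * (1 + m * Real.exp (-L)) := by
        simp [← Finset.mul_sum, Finset.sum_add_distrib]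

/-- Lower bound for the smoothed word distribution by averaging over a set of large measure. -/
theorem neg_log_integral_exp_neg_le {X : Type*} [MeasurableSpace X] {ν : Measure X}
    [IsProbabilityMeasure ν] {u : X → ℝ} {a c η : ℝ} (hu : Measurable u)
    (hu0 : ∀ y, 0 ≤ u y) (huc : ∀ y, u y ≤ c) (hη : 0 < η) {E : Set X}
    (hEη : η ≤ ν.real E) :
    -Real.log (∫ y, Real.exp (-(a + u y)) ∂ν) ≤
      -Real.log η + a + η⁻¹ * ∫ y in E, u y ∂ν := by
  have hEpos : 0 < ν.real E := hη.trans_le hEη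
  have huint : Integrable u ν := .of_bound hu.aestronglyMeasurable c
    (ae_of_all _ fun y => by rw [Real.norm_of_nonneg (hu0 y)]; exact huc y)
  have hexp : Integrable (fun y => Real.exp (-(a + u y))) ν :=
    .of_bound (by fun_prop) (Real.exp (-a)) (ae_of_all _ fun y => by
      rw [Real.norm_of_nonneg (Real.exp_pos _).le]
      exact Real.exp_le_exp.2 (by linarith [hu0 y]))
  have : NeZero (ν.restrict E) := ⟨fun h => by
    rw [Measure.restrict_eq_zero] at h
    simp [Measure.real, h] at hEpos⟩
  set I := ∫ y in E, u y ∂ν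
  have hI : 0 ≤ I := integral_nonneg fun y => hu0 y
  have hlin : Integrable (fun y => -(a + u y)) (ν.restrict E) :=
    ((integrable_const a).add huint.integrableOn).neg
  have hjensen := convexOn_exp.map_average_le (μ := ν.restrict E)
    (f := fun y => -(a + u y)) Real.continuous_exp.continuousOn isClosed_univ
    (ae_of_all _ fun _ => Set.mem_univ _) hlin hexp.integrableOn
  have havg : (⨍ y in E, -(a + u y) ∂ν) = -(a + (ν.real E)⁻¹ * I) := by
    rw [setAverage_eq, integral_neg, integral_add (integrable_const a) huint.integrableOn]
    simp only [setIntegral_const, smul_eq_mul]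
    field_simp
    rfl
  rw [havg, setAverage_eq, smul_eq_mul] at hjensen
  have hlower : η * Real.exp (-(a + η⁻¹ * I)) ≤ ∫ y, Real.exp (-(a + u y)) ∂ν := by
    calc η * Real.exp (-(a + η⁻¹ * I))
        ≤ ν.real E * Real.exp (-(a + (ν.real E)⁻¹ * I)) := by gcongr
      _ ≤ ν.real E * ((ν.real E)⁻¹ * ∫ y in E, Real.exp (-(a + u y)) ∂ν) := by gcongr
      _ = ∫ y in E, Real.exp (-(a + u y)) ∂ν := by field_simp
      _ ≤ ∫ y, Real.exp (-(a + u y)) ∂ν :=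
        setIntegral_le_integral hexp (ae_of_all _ fun y => (Real.exp_pos _).le)
  have hlog := Real.log_le_log (by positivity) hlower
  rw [Real.log_mul hη.ne' (Real.exp_pos _).ne', Real.log_exp] at hlog
  linarith

/-- The entropy of a finite-word-valued map is controlled by the average number of mismatches
between two related points, up to the set of points with few relatives. -/
theorem sum_negMulLog_measureReal_preimage_le {X : Type*} [MeasurableSpace X] {ν : Measure X}
    [IsProbabilityMeasure ν] {n m : ℕ} {σ : X → Fin n → Fin m} (hσ : Measurable σ)
    {R : Set (X × X)} (hR : MeasurableSet R) {α L η : ℝ} (hL : 0 ≤ L) (hη : 0 < η)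
    (hη1 : η ≤ 1) (hαL : Real.exp (-α) * (1 + m * Real.exp (-L)) ≤ 1) :
    ∑ s, Real.negMulLog (ν.real (σ ⁻¹' {s})) ≤ -Real.log η + α * n
      + L * η⁻¹ * ∑ j, (ν.prod ν).real (R ∩ {z | σ z.1 j ≠ σ z.2 j})
      + L * n * ν.real {x | ν.real (Prod.mk x ⁻¹' R) < η} := by
  set q : (Fin n → Fin m) → ℝ := fun s => ∫ y, Real.exp (-(α * n + L * mismatch s (σ y))) ∂ν
  have hmis : ∀ s, Measurable fun y => mismatch s (σ y) := fun s =>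
    (Measurable.of_discrete (f := mismatch s)).comp hσ
  have hmis2 : Measurable fun z : X × X => mismatch (σ z.1) (σ z.2) :=
    (Measurable.of_discrete (f := fun p : (Fin n → Fin m) × (Fin n → Fin m) =>
      mismatch p.1 p.2)).comp (hσ.prodMap hσ)
  have hexp : ∀ s, Integrable (fun y => Real.exp (-(α * n + L * mismatch s (σ y)))) ν := by
    intro s
    have := hmis s
    refine .of_bound (by fun_prop) (Real.exp (-(α * n))) (ae_of_all _ fun y => ?_)
    rw [Real.norm_of_nonneg (Real.exp_pos _).le]
    exact Real.exp_le_exp.2 (by nlinarith [mismatch_nonneg s (σ y)])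
  have hq : ∀ s, 0 < q s := fun s => integral_exp_pos (hexp s)
  have hq1 : ∑ s, q s ≤ 1 := by
    rw [← integral_finsetSum _ fun s _ => hexp s]
    calc ∫ y, ∑ s, Real.exp (-(α * n + L * mismatch s (σ y))) ∂ν ≤ ∫ _, (1 : ℝ) ∂ν :=
          integral_mono (integrable_finsetSum _ fun s _ => hexp s) (integrable_const _)
            fun y => sum_exp_neg_mismatch_le_one hαL (σ y)
      _ = 1 := by simp
  have := Measure.isProbabilityMeasure_map (μ := ν) hσ.aemeasurable
  have hmap : ∀ s, (ν.map σ).real {s} = ν.real (σ ⁻¹' {s}) := fun s =>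
    map_measureReal_apply hσ (measurableSet_singleton s)
  have hp1 : ∑ s, ν.real (σ ⁻¹' {s}) = 1 := by
    simp_rw [← hmap]
    simp
  have hcross : ∑ s, ν.real (σ ⁻¹' {s}) * -Real.log (q s) = ∫ x, -Real.log (q (σ x)) ∂ν := by
    rw [← integral_map (f := fun s => -Real.log (q s)) hσ.aemeasurable
      (Measurable.of_discrete).aestronglyMeasurable, integral_fintype .of_finite]
    simp [hmap]
  set bad : Set X := {x | ν.real (Prod.mk x ⁻¹' R) < η}
  have hbad : MeasurableSet bad :=
    measurableSet_lt (measurable_measure_prodMk_left hR).ennreal_toReal measurable_const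
  set g : X × X → ℝ := R.indicator fun z => mismatch (σ z.1) (σ z.2)
  have hg : Integrable g (ν.prod ν) :=
    (Integrable.of_bound hmis2.aestronglyMeasurable n (ae_of_all _ fun z => by
      rw [Real.norm_of_nonneg (mismatch_nonneg _ _)]; exact mismatch_le _ _)).indicator hR
  have hgint : ∫ x, ∫ y, g (x, y) ∂ν ∂ν =
      ∑ j, (ν.prod ν).real (R ∩ {z | σ z.1 j ≠ σ z.2 j}) := by
    rw [← integral_prod g hg]
    have hσj : ∀ j, MeasurableSet {z : X × X | σ z.1 j ≠ σ z.2 j} := fun j =>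
      (measurableSet_eq_fun ((measurable_pi_apply j).comp (hσ.comp measurable_fst))
        ((measurable_pi_apply j).comp (hσ.comp measurable_snd))).compl
    have hgsum : g = fun z => ∑ j, (R ∩ {z | σ z.1 j ≠ σ z.2 j}).indicator (fun _ => (1 : ℝ)) z := by
      funext z
      by_cases hz : z ∈ R
      · simp only [g, Set.indicator_of_mem hz, mismatch]
        refine Finset.sum_congr rfl fun j _ => ?_
        by_cases h : σ z.1 j = σ z.2 j <;> simp [Set.indicator, hz, h]
      · simp [g, hz]
    rw [hgsum, integral_finsetSum _ fun j _ =>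
      (integrable_const _).indicator (hR.inter (hσj j))]
    refine Finset.sum_congr rfl fun j _ => ?_
    rw [integral_indicator (hR.inter (hσj j))]
    simp
  have hg0 : ∀ x, 0 ≤ ∫ y, g (x, y) ∂ν := fun x => integral_nonneg fun y =>
    Set.indicator_nonneg (fun z _ => mismatch_nonneg _ _) _
  have hpoint : ∀ x, -Real.log (q (σ x)) ≤ -Real.log η + α * n + L * η⁻¹ * ∫ y, g (x, y) ∂ν
      + L * n * bad.indicator (fun _ => 1) x := by
    intro x
    have hm : Measurable fun y => L * mismatch (σ x) (σ y) := (hmis (σ x)).const_mul L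
    have hm0 : ∀ y, 0 ≤ L * mismatch (σ x) (σ y) := fun y => mul_nonneg hL (mismatch_nonneg _ _)
    have hmn : ∀ y, L * mismatch (σ x) (σ y) ≤ L * n := fun y =>
      mul_le_mul_of_nonneg_left (mismatch_le _ _) hL
    by_cases hx : x ∈ bad
    · have hb := neg_log_integral_exp_neg_le (ν := ν) (a := α * n) hm hm0 hmn one_pos
        (E := Set.univ) (by simp)
      have hle : ∫ y in Set.univ, L * mismatch (σ x) (σ y) ∂ν ≤ L * n := by
        calc ∫ y in Set.univ, L * mismatch (σ x) (σ y) ∂ν ≤ ∫ _ in Set.univ, L * n ∂ν :=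
              integral_mono (.of_bound hm.aestronglyMeasurable (L * n) (ae_of_all _ fun y => by
                rw [Real.norm_of_nonneg (hm0 y)]; exact hmn y)) (integrable_const _) hmn
          _ = L * n := by simp
      have hlog : Real.log η ≤ 0 := Real.log_nonpos hη.le hη1
      have hgx : 0 ≤ L * η⁻¹ * ∫ y, g (x, y) ∂ν := mul_nonneg (by positivity) (hg0 x)
      simp only [Set.indicator_of_mem hx, mul_one]
      simp only [Real.log_one, neg_zero, zero_add, inv_one, one_mul] at hb
      change -Real.log (∫ y, Real.exp (-(α * n + L * mismatch (σ x) (σ y))) ∂ν) ≤ _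
      linarith
    · have hE : MeasurableSet (Prod.mk x ⁻¹' R) := measurable_prodMk_left hR
      have hb := neg_log_integral_exp_neg_le (ν := ν) (a := α * n) hm hm0 hmn hη
        (not_lt.1 hx)
      have hgx : ∫ y in Prod.mk x ⁻¹' R, L * mismatch (σ x) (σ y) ∂ν =
          L * ∫ y, g (x, y) ∂ν := by
        rw [← integral_indicator hE, ← integral_const_mul]
        refine integral_congr_ae (ae_of_all _ fun y => ?_)
        by_cases hy : (x, y) ∈ R <;> simp [g, hy]
      simp only [Set.indicator_of_notMem hx, mul_zero, add_zero]
      rw [hgx] at hb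
      change -Real.log (∫ y, Real.exp (-(α * n + L * mismatch (σ x) (σ y))) ∂ν) ≤ _
      linarith
  refine (sum_negMulLog_le_sum_mul_neg_log (fun s => measureReal_nonneg) hp1 hq hq1).trans ?_
  have hbint : Integrable (bad.indicator fun _ => (1 : ℝ)) ν := (integrable_const _).indicator hbad
  have hgx : Integrable (fun x => ∫ y, g (x, y) ∂ν) ν := hg.integral_prod_left
  have hconst : Integrable
      (fun x => -Real.log η + α * n + L * η⁻¹ * ∫ y, g (x, y) ∂ν) ν :=
    (integrable_const _).add (hgx.const_mul _)
  have hqint : Integrable (fun x => -Real.log (q (σ x))) ν :=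
    (Integrable.of_finite (μ := ν.map σ) (f := fun s => -Real.log (q s))).comp_measurable hσ
  calc ∑ s, ν.real (σ ⁻¹' {s}) * -Real.log (q s) = ∫ x, -Real.log (q (σ x)) ∂ν := hcross
    _ ≤ ∫ x, (-Real.log η + α * n + L * η⁻¹ * ∫ y, g (x, y) ∂ν
        + L * n * bad.indicator (fun _ => 1) x) ∂ν :=
      integral_mono hqint (hconst.add (hbint.const_mul _)) hpoint
    _ = _ := by
      rw [integral_add hconst (hbint.const_mul _),
        integral_add (integrable_const _) (hgx.const_mul _), integral_const_mul,
        integral_const_mul, hgint, integral_indicator hbad]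
      simp

theorem integrable_measureReal_prodMk_preimage {Ω Y : Type*} [MeasurableSpace Ω]
    [MeasurableSpace Y] {ρ : Measure Ω} [IsFiniteMeasure ρ] (κ : Kernel Ω Y) [IsMarkovKernel κ]
    {s : Set (Ω × Y)} (hs : MeasurableSet s) :
    Integrable (fun w => (κ w).real (Prod.mk w ⁻¹' s)) ρ :=
  .of_bound (Kernel.measurable_kernel_prodMk_left hs).ennreal_toReal.aestronglyMeasurable 1
    (ae_of_all _ fun w => by rw [Real.norm_of_nonneg measureReal_nonneg]; exact measureReal_le_one)

theorem integral_measureReal_prodMk_preimage {Ω Y : Type*} [MeasurableSpace Ω]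
    [MeasurableSpace Y] {ρ : Measure Ω} [IsFiniteMeasure ρ] (κ : Kernel Ω Y) [IsMarkovKernel κ]
    {s : Set (Ω × Y)} (hs : MeasurableSet s) :
    ∫ w, (κ w).real (Prod.mk w ⁻¹' s) ∂ρ = (ρ ⊗ₘ κ).real s := by
  rw [measureReal_def, Measure.compProd_apply hs]
  exact integral_toReal (Kernel.measurable_kernel_prodMk_left hs).aemeasurable
    (ae_of_all _ fun w => measure_lt_top _ _)

/-- The skew product generated by the fiber maps `f` over the base map `θ`. -/
def skewProduct {Ω X : Type*} (f : Ω → X → X) (θ : Ω → Ω) (p : Ω × X) : Ω × X :=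
  (θ p.1, f p.1 p.2)

theorem iterate_skewProduct {Ω X : Type*} (f : Ω → X → X) (θ : Ω → Ω) (n : ℕ) (w : Ω) (x : X) :
    (skewProduct f θ)^[n] (w, x) = (θ^[n] w, fiterate f θ n w x) := by
  induction n generalizing w x with
  | zero => rfl
  | succ n ih => exact ih (θ w) (f w x)

section Stable

variable {Ω X : Type*} [MetricSpace X] {f : Ω → X → X} {θ : Ω → Ω} {w : Ω} {x y : X}

theorem wStable_eq_of_mem (h : y ∈ wStable f θ w x) : wStable f θ w y = wStable f θ w x := by
  have htrans : ∀ {a b c : X}, Tendsto (fun n => dist (fiterate f θ n w a) (fiterate f θ n w b))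
      atTop (𝓝 0) → Tendsto (fun n => dist (fiterate f θ n w b) (fiterate f θ n w c))
      atTop (𝓝 0) → Tendsto (fun n => dist (fiterate f θ n w a) (fiterate f θ n w c))
      atTop (𝓝 0) := fun h1 h2 =>
    squeeze_zero (fun _ => dist_nonneg) (fun _ => dist_triangle _ _ _) (by simpa using h1.add h2)
  have h' : Tendsto (fun n => dist (fiterate f θ n w x) (fiterate f θ n w y)) atTop (𝓝 0) :=
    (show Tendsto (fun n => dist (fiterate f θ n w y) (fiterate f θ n w x)) atTop (𝓝 0)
      from h).congr fun _ => dist_comm _ _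
  ext z
  exact ⟨fun hz => htrans hz h, fun hz => htrans hz h'⟩

theorem preimage_wStable : f w ⁻¹' wStable f θ (θ w) (f w x) = wStable f θ w x := by
  ext y
  exact tendsto_add_atTop_iff_nat
    (f := fun n => dist (fiterate f θ n w y) (fiterate f θ n w x)) 1

variable [MeasurableSpace Ω] [MeasurableSpace X] [BorelSpace X] [SecondCountableTopology X]

theorem measurable_dist_iterate (hF : Measurable (skewProduct f θ)) (n : ℕ) :
    Measurable fun z : Ω × X × X => dist (fiterate f θ n z.1 z.2.2) (fiterate f θ n z.1 z.2.1) := by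
  have hn := (hF.iterate n).snd
  simpa [iterate_skewProduct] using
    (hn.comp (measurable_fst.prodMk measurable_snd.snd)).dist
      (hn.comp (measurable_fst.prodMk measurable_snd.fst))

theorem measurableSet_stablePairs (hF : Measurable (skewProduct f θ)) :
    MeasurableSet {z : Ω × X × X | z.2.2 ∈ wStable f θ z.1 z.2.1} :=
  measurableSet_tendsto (𝓝 0) (measurable_dist_iterate hF)

theorem measurableSet_wStable (hF : Measurable (skewProduct f θ)) (w : Ω) (x : X) :
    MeasurableSet (wStable f θ w x) :=
  measurable_prodMk_left (measurable_prodMk_left (measurableSet_stablePairs hF))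

theorem measurable_measure_wStable (hF : Measurable (skewProduct f θ)) (κ : Kernel Ω X)
    [IsSFiniteKernel κ] :
    Measurable fun p : Ω × X => κ p.1 (wStable f θ p.1 p.2) :=
  Kernel.measurable_kernel_prodMk_left (κ := κ.comap Prod.fst measurable_fst)
    (t := {q : (Ω × X) × X | q.2 ∈ wStable f θ q.1.1 q.1.2})
    (MeasurableEquiv.prodAssoc.measurable (measurableSet_stablePairs hF))

/-- The set of points whose stable class has positive fiber measure is almost backward invariant. -/
theorem preimage_positive_wStable_ae_le (hF : Measurable (skewProduct f θ)) (ρ : Measure Ω)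
    [SFinite ρ] (κ : Kernel Ω X) [IsFiniteKernel κ] :
    skewProduct f θ ⁻¹' {p | κ p.1 (wStable f θ p.1 p.2) ≠ 0} ≤ᵐ[ρ ⊗ₘ κ]
      {p | κ p.1 (wStable f θ p.1 p.2) ≠ 0} := by
  have hA : MeasurableSet {p : Ω × X | κ p.1 (wStable f θ p.1 p.2) ≠ 0} :=
    (measurable_measure_wStable hF κ (measurableSet_singleton 0)).compl
  refine Measure.ae_compProd_of_ae_ae
    (p := fun p => p ∈ skewProduct f θ ⁻¹' {p | κ p.1 (wStable f θ p.1 p.2) ≠ 0} →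
      p ∈ {p : Ω × X | κ p.1 (wStable f θ p.1 p.2) ≠ 0}) ?_ (ae_of_all _ fun w => ?_)
  · have : MeasurableSet ((skewProduct f θ ⁻¹' {p | κ p.1 (wStable f θ p.1 p.2) ≠ 0})ᶜ ∪
      {p | κ p.1 (wStable f θ p.1 p.2) ≠ 0}) := (hF hA).compl.union hA
    convert this using 1
    ext p
    exact imp_iff_not_or
  · let As : Set.range (wStable f θ (θ w)) → Set X := Subtype.val
    have hAs : ∀ i, MeasurableSet (As i) := by
      rintro ⟨_, y, rfl⟩
      exact measurableSet_wStable hF _ _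
    have hdisj : Pairwise (Function.onFun Disjoint As) := by
      rintro ⟨_, y, rfl⟩ ⟨_, z, rfl⟩ hne
      refine Set.disjoint_left.2 fun a hy hz => hne (Subtype.ext ?_)
      exact (wStable_eq_of_mem hy).symm.trans (wStable_eq_of_mem hz)
    have hcount := Measure.countable_meas_pos_of_disjoint_iUnion (μ := κ (θ w)) hAs hdisj
    have hclass : ∀ i, ∀ᵐ x ∂κ w, f w x ∈ As i → κ w (wStable f θ w x) ≠ 0 := by
      rintro ⟨_, y, rfl⟩
      by_cases h0 : κ w (f w ⁻¹' wStable f θ (θ w) y) = 0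
      · filter_upwards [measure_eq_zero_iff_ae_notMem.1 h0] with x hx hx'
        exact absurd hx' hx
      · refine ae_of_all _ fun x hx => ?_
        rwa [← preimage_wStable, wStable_eq_of_mem hx]
    filter_upwards [(ae_ball_iff hcount).2 fun i _ => hclass i] with x hx hpos
    exact hx ⟨_, f w x, rfl⟩ (pos_iff_ne_zero.2 hpos) (by simp [As, wStable])

end Stable

theorem exists_exp_neg_mul_one_add_le_one {α : ℝ} (hα : 0 < α) (m : ℕ) :
    ∃ L, 0 ≤ L ∧ Real.exp (-α) * (1 + m * Real.exp (-L)) ≤ 1 := by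
  have hlim : Tendsto (fun L : ℝ => Real.exp (-α) * (1 + m * Real.exp (-L))) atTop
      (𝓝 (Real.exp (-α) * (1 + m * 0))) :=
    ((Real.tendsto_exp_neg_atTop_nhds_zero.const_mul _).const_add _).const_mul _
  have hlt : Real.exp (-α) * (1 + m * 0) < 1 := by simpa using hα
  obtain ⟨L, hL, hL0⟩ := ((hlim.eventually_lt_const hlt).and (eventually_ge_atTop 0)).exists
  exact ⟨L, hL0, hL.le⟩

section Entropy

variable {Ω X : Type*} [MeasurableSpace Ω] [MetricSpace X] [MeasurableSpace X] [BorelSpace X]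
  [SecondCountableTopology X] {f : Ω → X → X} {θ : Ω → Ω} {ρ : Measure Ω}
  [IsProbabilityMeasure ρ] {κ : Kernel Ω X} [IsMarkovKernel κ] {m : ℕ}

theorem fiberHn_le_s15 (hF : Measurable (skewProduct f θ)) {P : Fin m → Set (Ω × X)}
    {idx : Ω × X → Fin m} (hidx : Measurable idx) (hP : ∀ p a, p ∈ P a ↔ idx p = a)
    {α L η : ℝ} (hL : 0 ≤ L) (hη : 0 < η) (hη1 : η ≤ 1)
    (hαL : Real.exp (-α) * (1 + m * Real.exp (-L)) ≤ 1) (n : ℕ) :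
    fiberHn ρ κ f θ P n ≤ -Real.log η + α * n
      + L * η⁻¹ * ∑ j ∈ Finset.range n,
        ((ρ ⊗ₘ (κ ×ₖ κ)).restrict {z | z.2.2 ∈ wStable f θ z.1 z.2.1}).real
          {z | idx ((skewProduct f θ)^[j] (z.1, z.2.1)) ≠
            idx ((skewProduct f θ)^[j] (z.1, z.2.2))}
      + L * n * (ρ ⊗ₘ κ).real {p | (κ p.1).real (wStable f θ p.1 p.2) < η} := by
  set R : Set (Ω × X × X) := {z | z.2.2 ∈ wStable f θ z.1 z.2.1}
  have hR : MeasurableSet R := measurableSet_stablePairs hF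
  set D : ℕ → Set (Ω × X × X) := fun j => {z | idx ((skewProduct f θ)^[j] (z.1, z.2.1)) ≠
    idx ((skewProduct f θ)^[j] (z.1, z.2.2))}
  have hD : ∀ j, MeasurableSet (D j) := fun j =>
    (measurableSet_eq_fun
      ((hidx.comp (hF.iterate j)).comp (measurable_fst.prodMk measurable_snd.fst))
      ((hidx.comp (hF.iterate j)).comp (measurable_fst.prodMk measurable_snd.snd))).compl
  set B : Set (Ω × X) := {p | (κ p.1).real (wStable f θ p.1 p.2) < η}
  have hB : MeasurableSet B :=
    measurableSet_lt (measurable_measure_wStable hF κ).ennreal_toReal measurable_const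
  let σ : Ω → X → Fin n → Fin m := fun w x j => idx ((skewProduct f θ)^[j] (w, x))
  have hσ : ∀ w, Measurable (σ w) := fun w => measurable_pi_lambda _ fun j =>
    (hidx.comp (hF.iterate j)).comp measurable_prodMk_left
  have hcell : ∀ w s, cellSet f θ P w s = σ w ⁻¹' {s} := by
    intro w s
    ext x
    simp [cellSet, hP, σ, iterate_skewProduct, funext_iff]
  have hpoint : ∀ w, ∑ s : Fin n → Fin m, Real.negMulLog ((κ w (cellSet f θ P w s)).toReal) ≤
      -Real.log η + α * n + L * η⁻¹ * ∑ j ∈ Finset.range n,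
        ((κ ×ₖ κ) w).real (Prod.mk w ⁻¹' (D j ∩ R)) + L * n * (κ w).real (Prod.mk w ⁻¹' B) := by
    intro w
    have h := sum_negMulLog_measureReal_preimage_le (ν := κ w) (hσ w)
      (R := Prod.mk w ⁻¹' R) (measurable_prodMk_left hR) hL hη hη1 hαL
    simp only [hcell, Kernel.prod_apply]
    rw [← Fin.sum_univ_eq_sum_range
      (fun j => ((κ w).prod (κ w)).real (Prod.mk w ⁻¹' (D j ∩ R)))]
    simp only [Set.inter_comm (D _)]
    exact h
  have hDint : ∀ j ∈ Finset.range n,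
      Integrable (fun w => ((κ ×ₖ κ) w).real (Prod.mk w ⁻¹' (D j ∩ R))) ρ := fun j _ =>
    integrable_measureReal_prodMk_preimage _ ((hD j).inter hR)
  have hconst : Integrable (fun w => -Real.log η + α * n + L * η⁻¹ * ∑ j ∈ Finset.range n,
      ((κ ×ₖ κ) w).real (Prod.mk w ⁻¹' (D j ∩ R))) ρ :=
    (integrable_const _).add ((integrable_finsetSum _ hDint).const_mul _)
  have hBint := integrable_measureReal_prodMk_preimage (ρ := ρ) κ hB
  have hsum : ∑ j ∈ Finset.range n,
      ∫ w, ((κ ×ₖ κ) w).real (Prod.mk w ⁻¹' (D j ∩ R)) ∂ρ =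
      ∑ j ∈ Finset.range n, ((ρ ⊗ₘ (κ ×ₖ κ)).restrict R).real (D j) :=
    Finset.sum_congr rfl fun j _ =>
      (integral_measureReal_prodMk_preimage _ ((hD j).inter hR)).trans
        (measureReal_restrict_apply (hD j)).symm
  calc fiberHn ρ κ f θ P n ≤ ∫ w, (-Real.log η + α * n + L * η⁻¹ * ∑ j ∈ Finset.range n,
        ((κ ×ₖ κ) w).real (Prod.mk w ⁻¹' (D j ∩ R))
        + L * n * (κ w).real (Prod.mk w ⁻¹' B)) ∂ρ :=
      integral_mono_of_nonneg (ae_of_all _ fun w => Finset.sum_nonneg fun s _ =>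
        Real.negMulLog_nonneg measureReal_nonneg measureReal_le_one)
        (hconst.add (hBint.const_mul _)) (ae_of_all _ hpoint)
    _ = _ := by
      rw [integral_add hconst (hBint.const_mul _),
        integral_add (integrable_const _) ((integrable_finsetSum _ hDint).const_mul _),
        integral_const_mul, integral_const_mul, integral_finsetSum _ hDint,
        integral_measureReal_prodMk_preimage κ hB, hsum, integral_const, probReal_univ, one_smul]

/-- Points in the same stable class asymptotically have the same itinerary, in measure. -/
theorem tendsto_measureReal_itinerary_ne
    (hF : MeasurePreserving (skewProduct f θ) (ρ ⊗ₘ κ) (ρ ⊗ₘ κ))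
    {idx : Ω × X → Fin m} (hidx : Measurable idx) :
    Tendsto (fun j => ((ρ ⊗ₘ (κ ×ₖ κ)).restrict {z | z.2.2 ∈ wStable f θ z.1 z.2.1}).real
      {z | idx ((skewProduct f θ)^[j] (z.1, z.2.1)) ≠
        idx ((skewProduct f θ)^[j] (z.1, z.2.2))}) atTop (𝓝 0) := by
  set R : Set (Ω × X × X) := {z | z.2.2 ∈ wStable f θ z.1 z.2.1}
  have hR : MeasurableSet R := measurableSet_stablePairs hF.measurable
  set l := (ρ ⊗ₘ (κ ×ₖ κ)).restrict R
  let U : ℕ → Ω × X × X → Ω × X := fun j z => (skewProduct f θ)^[j] (z.1, z.2.1)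
  let V : ℕ → Ω × X × X → Ω × X := fun j z => (skewProduct f θ)^[j] (z.1, z.2.2)
  have hpx : Measurable fun z : Ω × X × X => (z.1, z.2.1) :=
    measurable_fst.prodMk measurable_snd.fst
  have hpy : Measurable fun z : Ω × X × X => (z.1, z.2.2) :=
    measurable_fst.prodMk measurable_snd.snd
  have hU : ∀ j, Measurable (U j) := fun j => (hF.measurable.iterate j).comp hpx
  have hV : ∀ j, Measurable (V j) := fun j => (hF.measurable.iterate j).comp hpy
  have hUρ : ∀ j T, MeasurableSet T → l (U j ⁻¹' T) ≤ (ρ ⊗ₘ κ) T := by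
    intro j T hT
    have hT' := (hF.measurable.iterate j) hT
    rw [← (hF.iterate j).measure_preimage hT.nullMeasurableSet, Measure.compProd_apply hT']
    refine (Measure.restrict_apply_le _ _).trans ?_
    rw [Measure.compProd_apply (hU j hT)]
    refine lintegral_mono fun w => le_of_eq ?_
    have : Prod.mk w ⁻¹' (U j ⁻¹' T) =
        (Prod.mk w ⁻¹' ((skewProduct f θ)^[j] ⁻¹' T)) ×ˢ Set.univ := by
      ext z
      simp [U]
    rw [this, Kernel.prod_apply, Measure.prod_prod]
    simp
  have hVρ : ∀ j T, MeasurableSet T → l (V j ⁻¹' T) ≤ (ρ ⊗ₘ κ) T := by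
    intro j T hT
    have hT' := (hF.measurable.iterate j) hT
    rw [← (hF.iterate j).measure_preimage hT.nullMeasurableSet, Measure.compProd_apply hT']
    refine (Measure.restrict_apply_le _ _).trans ?_
    rw [Measure.compProd_apply (hV j hT)]
    refine lintegral_mono fun w => le_of_eq ?_
    have : Prod.mk w ⁻¹' (V j ⁻¹' T) =
        Set.univ ×ˢ (Prod.mk w ⁻¹' ((skewProduct f θ)^[j] ⁻¹' T)) := by
      ext z
      simp [V]
    rw [this, Kernel.prod_apply, Measure.prod_prod]
    simp
  have hdist : ∀ᵐ z ∂l, Tendsto (fun j => dist (U j z).2 (V j z).2) atTop (𝓝 0) := by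
    filter_upwards [ae_restrict_mem hR] with z hz
    simp only [U, V, iterate_skewProduct]
    exact (show Tendsto (fun n => dist (fiterate f θ n z.1 z.2.2) (fiterate f θ n z.1 z.2.1))
      atTop (𝓝 0) from hz).congr fun _ => dist_comm _ _
  have hsep : ∀ a, Tendsto (fun j => l {z | ¬ (U j z ∈ idx ⁻¹' {a} ↔ V j z ∈ idx ⁻¹' {a})})
      atTop (𝓝 0) := fun a =>
    tendsto_measure_separated hU hV hUρ hVρ (fun j z => by simp [U, V, iterate_skewProduct])
      hdist (hidx (measurableSet_singleton a))
  have hsum : Tendsto (fun j => ∑ a, l {z | ¬ (U j z ∈ idx ⁻¹' {a} ↔ V j z ∈ idx ⁻¹' {a})})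
      atTop (𝓝 0) := by
    simpa using tendsto_finsetSum Finset.univ fun a _ => hsep a
  have hmeas : Tendsto (fun j => l {z | idx (U j z) ≠ idx (V j z)}) atTop (𝓝 0) := by
    refine tendsto_of_tendsto_of_tendsto_of_le_of_le tendsto_const_nhds hsum
      (fun _ => zero_le) fun j => ?_
    refine (measure_mono fun z hz => ?_).trans (measure_iUnion_fintype_le _ _)
    refine Set.mem_iUnion.2 ⟨idx (U j z), fun h => hz ?_⟩
    exact (h.1 rfl).symm
  exact (ENNReal.tendsto_toReal ENNReal.zero_ne_top).comp hmeas

/-- If almost every point lies in a stable class of positive fiber measure, then every finite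
measurable partition has zero fiber entropy. -/
theorem fiberEntropyOfPartition_nonpos
    (hF : MeasurePreserving (skewProduct f θ) (ρ ⊗ₘ κ) (ρ ⊗ₘ κ))
    (hpos : ∀ᵐ p ∂(ρ ⊗ₘ κ), κ p.1 (wStable f θ p.1 p.2) ≠ 0)
    {P : Fin m → Set (Ω × X)} (hPm : ∀ i, MeasurableSet (P i))
    (hPd : Pairwise (Function.onFun Disjoint P)) (hPu : ⋃ i, P i = Set.univ) :
    fiberEntropyOfPartition ρ κ f θ P ≤ 0 := by
  have hex : ∀ p, ∃ a, p ∈ P a := fun p => Set.mem_iUnion.1 (hPu ▸ Set.mem_univ p)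
  choose idx hidx using hex
  have hP : ∀ p a, p ∈ P a ↔ idx p = a := fun p a =>
    ⟨fun h => by_contra fun hne => Set.disjoint_left.1 (hPd hne) (hidx p) h, fun h => h ▸ hidx p⟩
  have hidxm : Measurable idx := measurable_to_countable' fun a => by
    convert hPm a using 1
    ext p
    exact (hP p a).symm
  by_contra! hlt
  set h := fiberEntropyOfPartition ρ κ f θ P
  obtain ⟨L, hL, hαL⟩ := exists_exp_neg_mul_one_add_le_one (α := h / 4) (by positivity) m
  have hsmall : Tendsto (fun k : ℕ =>
      (ρ ⊗ₘ κ).real {p | (κ p.1).real (wStable f θ p.1 p.2) < 1 / ((k : ℝ) + 1)})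
      atTop (𝓝 0) := by
    have hmeas : ∀ k : ℕ, MeasurableSet
        {p : Ω × X | (κ p.1).real (wStable f θ p.1 p.2) < 1 / ((k : ℝ) + 1)} := fun k =>
      measurableSet_lt (measurable_measure_wStable hF.measurable κ).ennreal_toReal
        measurable_const
    have hlim := tendsto_measure_iInter_atTop (μ := ρ ⊗ₘ κ)
      (fun k => (hmeas k).nullMeasurableSet)
      (fun a b hab p hp => lt_of_lt_of_le
        (show (κ p.1).real (wStable f θ p.1 p.2) < 1 / ((b : ℝ) + 1) from hp)
        (Nat.one_div_le_one_div hab))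
      ⟨0, measure_ne_top _ _⟩
    have hnull : (ρ ⊗ₘ κ)
        (⋂ k : ℕ, {p | (κ p.1).real (wStable f θ p.1 p.2) < 1 / ((k : ℝ) + 1)}) = 0 := by
      have hzero : (ρ ⊗ₘ κ) {p | ¬ κ p.1 (wStable f θ p.1 p.2) ≠ 0} = 0 := ae_iff.1 hpos
      refine measure_mono_null ?_ hzero
      intro p hp hne
      obtain ⟨k, hk⟩ := exists_nat_one_div_lt (ENNReal.toReal_pos hne (measure_ne_top _ _))
      exact lt_asymm hk (Set.mem_iInter.1 hp k)
    rw [hnull] at hlim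
    exact (ENNReal.tendsto_toReal ENNReal.zero_ne_top).comp hlim
  obtain ⟨k, hk⟩ := ((hsmall.const_mul L).eventually_lt_const
    (show L * 0 < h / 4 by rw [mul_zero]; positivity)).exists
  set η : ℝ := 1 / ((k : ℝ) + 1)
  have hη : 0 < η := by positivity
  have hη1 : η ≤ 1 := by
    rw [div_le_one (by positivity)]
    simp
  have hces := (tendsto_measureReal_itinerary_ne hF hidxm).cesaro
  have hupper : Tendsto (fun n : ℕ => -Real.log η * (n : ℝ)⁻¹ + L * η⁻¹ * ((n : ℝ)⁻¹ *
      ∑ j ∈ Finset.range n,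
        ((ρ ⊗ₘ (κ ×ₖ κ)).restrict {z | z.2.2 ∈ wStable f θ z.1 z.2.1}).real
          {z | idx ((skewProduct f θ)^[j] (z.1, z.2.1)) ≠
            idx ((skewProduct f θ)^[j] (z.1, z.2.2))})) atTop
      (𝓝 (-Real.log η * 0 + L * η⁻¹ * 0)) :=
    (tendsto_inv_atTop_nhds_zero_nat.const_mul _).add (hces.const_mul _)
  have hbdd : IsBoundedUnder (· ≥ ·) atTop fun n : ℕ => fiberHn ρ κ f θ P n / n :=
    isBoundedUnder_of ⟨0, fun n => div_nonneg (integral_nonneg fun w => Finset.sum_nonneg fun s _ =>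
      Real.negMulLog_nonneg measureReal_nonneg measureReal_le_one) n.cast_nonneg⟩
  have hlower := eventually_lt_of_lt_liminf (show 3 * h / 4 < h by linarith) hbdd
  obtain ⟨n, ⟨hn, hn'⟩, hn0⟩ := ((hlower.and (hupper.eventually_lt_const
    (show -Real.log η * 0 + L * η⁻¹ * 0 < h / 4 by simpa using hlt))).and
    (eventually_gt_atTop 0)).exists
  have hn0' : (0 : ℝ) < n := Nat.cast_pos.2 hn0
  have hle := div_le_div_of_nonneg_right
    (fiberHn_le_s15 (ρ := ρ) (κ := κ) hF.measurable hidxm hP hL hη hη1 hαL n) hn0'.le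
  refine absurd (hn.trans_le hle) (not_lt.2 ?_)
  rw [div_le_iff₀ hn0']
  have hmul := mul_lt_mul_of_pos_right hn' hn0'
  have hk' := mul_lt_mul_of_pos_right hk hn0'
  rw [add_mul, mul_assoc (-Real.log η), mul_assoc (L * η⁻¹), mul_right_comm (n : ℝ)⁻¹,
    inv_mul_cancel₀ hn0'.ne', mul_one, one_mul] at hmul
  linarith

end Entropy

end FiberEntropy

/-- Theorem A (2): if an ergodic invariant measure of a random dynamical system has
positive fiber entropy, then for ℙ-a.e. `w` every `w`-stable class has `μ_w`-measure
zero. -/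
theorem stmt_15 {Ω X : Type*} [MeasurableSpace Ω] [MetricSpace X] [CompactSpace X]
    [MeasurableSpace X] [BorelSpace X]
    (ℙ : Measure Ω) [IsProbabilityMeasure ℙ]
    (θ : Equiv.Perm Ω) (hθ : MeasurePreserving θ ℙ ℙ)
    (f : Ω → X → X) (hfcont : ∀ w, Continuous (f w))
    (μ : Ω → Measure X) (hμprob : ∀ w, IsProbabilityMeasure (μ w))
    (μtot : Measure (Ω × X)) (hμtotprob : IsProbabilityMeasure μtot)
    (hmarg : μtot.map Prod.fst = ℙ)
    (hdisint : ∀ s : Set (Ω × X), MeasurableSet s →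
      μtot s = ∫⁻ w, μ w (Prod.mk w ⁻¹' s) ∂ℙ)
    (herg : Ergodic (fun p : Ω × X => (θ p.1, f p.1 p.2)) μtot)
    (hent : 0 < fiberEntropy ℙ μ f (⇑θ)) :
    ∀ᵐ w ∂ℙ, ∀ p : X, μ w (wStable f (⇑θ) w p) = 0 := by
  have : Nonempty X := by
    obtain ⟨p⟩ := nonempty_of_isProbabilityMeasure μtot
    exact ⟨p.2⟩
  set κ : ProbabilityTheory.Kernel Ω X := μtot.condKernel
  have hfst : μtot.fst = ℙ := hmarg
  have hdis : ℙ.compProd κ = μtot := by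
    rw [← hfst]
    exact μtot.disintegrate μtot.condKernel
  have hμκ : ∀ᵐ w ∂ℙ, μ w = κ w := by
    refine ae_eq_kernel_of_lintegral_eq hμprob κ fun s hs => ?_
    rw [← hdisint s hs, ← Measure.compProd_apply hs, hdis]
  change Ergodic (skewProduct f θ) μtot at herg
  rw [← hdis] at herg
  have hA : MeasurableSet {p : Ω × X | κ p.1 (wStable f θ p.1 p.2) ≠ 0} :=
    (measurable_measure_wStable herg.measurable κ (measurableSet_singleton 0)).compl
  rcases herg.ae_empty_or_univ_of_preimage_ae_le hA.nullMeasurableSet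
    (preimage_positive_wStable_ae_le herg.measurable ℙ κ) with hempty | huniv
  · have hnull := Measure.ae_ae_of_ae_compProd
      (measure_eq_zero_iff_ae_notMem.1 (ae_eq_empty.1 hempty))
    filter_upwards [hμκ, hnull] with w hw hzero p
    rw [hw]
    by_contra hne
    refine hne (measure_mono_null (fun x hx => ?_) (ae_iff.1 hzero))
    simpa [wStable_eq_of_mem hx] using hne
  · exfalso
    obtain ⟨m, hm⟩ := exists_lt_of_lt_ciSup hent
    obtain ⟨P, hP⟩ := exists_lt_of_lt_ciSup hm
    by_cases hpart : (∀ i, MeasurableSet (P i)) ∧ Pairwise (Function.onFun Disjoint P) ∧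
        (⋃ i, P i) = Set.univ
    · rw [ciSup_pos hpart] at hP
      have hcongr : fiberEntropyOfPartition ℙ μ f θ P = fiberEntropyOfPartition ℙ κ f θ P := by
        have hn : ∀ n, fiberHn ℙ μ f θ P n = fiberHn ℙ κ f θ P n := fun n =>
          integral_congr_ae (hμκ.mono fun w hw => by simp only [hw])
        simp only [fiberEntropyOfPartition, hn]
      rw [hcongr] at hP
      exact hP.not_ge (fiberEntropyOfPartition_nonpos herg.toMeasurePreserving
        (eventuallyEq_univ.1 huniv) hpart.1 hpart.2.1 hpart.2.2)
    · simp [hpart] at hP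
end
end
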